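/- Let d be an odd positive integer and let l_1, …, l_r be finitely many rational prime numbers. Then there exist infinitely many number fields E (as subfields of a fixed algebraic closure of ℚ) such that: (i) E/ℚ is a Galois extension with cyclic Galois group of order 2d; (ii) E is a CM field, i.e. E is totally imaginary and contains a totally real subfield over which E has degree 2; and (iii) each of the primes l_1, …, l_r is inert in E/ℚ, i.e. the ideal l_i·O_E of the ring of integers O_E is a prime ideal. -/

import Mathlib

section

open NumberField IsDedekindDomain Filter Topology
open scoped ENNReal

/-- The Dedekind zeta function as an extended nonnegative real. -/
noncomputable def idealZeta (K : Type*) [Field K] [NumberField K] (s : ℝ) : ℝ≥0∞ :=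
  ∑' I : {I : Ideal (𝓞 K) // I ≠ 0}, (Ideal.absNorm I.1 : ℝ≥0∞) ^ (-s)

/-- The sum of `N(P) ^ (-s)` over the nonzero prime ideals `P`. -/
noncomputable def primeZeta (K : Type*) [Field K] [NumberField K] (s : ℝ) : ℝ≥0∞ :=
  ∑' P : HeightOneSpectrum (𝓞 K), (Ideal.absNorm P.asIdeal : ℝ≥0∞) ^ (-s)

section Zeta

variable (K : Type*) [Field K] [NumberField K]

theorem idealZeta_eq_tsum_enorm (s : ℝ) : idealZeta K s =
    ∑' n, ‖LSeries.term
      (fun n ↦ (Nat.card {I : Ideal (𝓞 K) // Ideal.absNorm I = n} : ℂ)) s n‖ₑ := by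
  rw [idealZeta, ← ENNReal.tsum_fiberwise _
    (fun I : {I : Ideal (𝓞 K) // I ≠ 0} ↦ Ideal.absNorm I.1)]
  refine tsum_congr fun n ↦ ?_
  rcases eq_or_ne n 0 with rfl | hn
  · rw [LSeries.term_zero, enorm_zero]
    refine ENNReal.tsum_eq_zero.2 ?_
    rintro ⟨⟨I, hI⟩, h⟩
    exact absurd (Ideal.absNorm_eq_zero_iff.1 h) hI
  have hpos : (0 : ℝ) < n := by positivity
  rw [LSeries.term_of_ne_zero hn, show ((n : ℂ) ^ (s : ℂ)) = (((n : ℝ) ^ s : ℝ) : ℂ) by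
    rw [Complex.ofReal_cpow hpos.le]; simp, ← ofReal_norm, norm_div,
    Complex.norm_real, Real.norm_of_nonneg (by positivity), Complex.norm_natCast,
    ENNReal.ofReal_div_of_pos (by positivity), ENNReal.ofReal_natCast,
    ← ENNReal.ofReal_rpow_of_pos hpos, ENNReal.ofReal_natCast]
  have h1 : ∀ b : ((fun I : {I : Ideal (𝓞 K) // I ≠ 0} ↦ Ideal.absNorm I.1) ⁻¹' {n}),
      (Ideal.absNorm b.1.1 : ℝ≥0∞) ^ (-s) = (n : ℝ≥0∞) ^ (-s) := by
    rintro ⟨I, h⟩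
    have : Ideal.absNorm I.1 = n := h
    simp only [this]
  rw [tsum_congr h1, ENNReal.tsum_const]
  have hcard : ENat.card ((fun I : {I : Ideal (𝓞 K) // I ≠ 0} ↦ Ideal.absNorm I.1) ⁻¹' {n}) =
      (Nat.card {I : Ideal (𝓞 K) // Ideal.absNorm I = n} : ℕ∞) := by
    have : Finite {I : Ideal (𝓞 K) // Ideal.absNorm I = n} :=
      (Ideal.finite_setOfPred_absNorm_eq n).to_subtype
    rw [← ENat.card_eq_coe_natCard]
    refine ENat.card_congr
      ⟨fun I ↦ ⟨I.1.1, I.2⟩, fun I ↦ ⟨⟨I.1, ?_⟩, I.2⟩, fun _ ↦ rfl, fun _ ↦ rfl⟩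
    intro h
    apply hn
    rw [← I.2, h]
    simp
  rw [hcard, ENNReal.rpow_neg, div_eq_mul_inv]
  simp

theorem idealZeta_of_summable {s : ℝ} (h : LSeriesSummable
    (fun n ↦ (Nat.card {I : Ideal (𝓞 K) // Ideal.absNorm I = n} : ℂ)) s) :
    idealZeta K s ≠ ∞ ∧ dedekindZeta K s = ((idealZeta K s).toReal : ℂ) := by
  have hn := h.norm
  rw [idealZeta_eq_tsum_enorm]
  simp_rw [← ofReal_norm]
  rw [← ENNReal.ofReal_tsum_of_nonneg (fun _ ↦ norm_nonneg _) hn]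
  refine ⟨ENNReal.ofReal_ne_top, ?_⟩
  rw [ENNReal.toReal_ofReal (tsum_nonneg fun _ ↦ norm_nonneg _), Complex.ofReal_tsum, dedekindZeta,
    LSeries]
  refine tsum_congr fun n ↦ ?_
  rcases eq_or_ne n 0 with rfl | hn
  · simp
  have hpos : (0 : ℝ) < n := by positivity
  rw [LSeries.term_of_ne_zero hn, show ((n : ℂ) ^ (s : ℂ)) = (((n : ℝ) ^ s : ℝ) : ℂ) by
    rw [Complex.ofReal_cpow hpos.le]; simp, norm_div, Complex.norm_real,
    Real.norm_of_nonneg (by positivity), Complex.norm_natCast]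
  simp

theorem eventually_lseriesSummable : ∀ᶠ s : ℝ in 𝓝[>] 1, LSeriesSummable
    (fun n ↦ (Nat.card {I : Ideal (𝓞 K) // Ideal.absNorm I = n} : ℂ)) s := by
  have h := tendsto_sub_one_mul_dedekindZeta_nhdsGT K
  have hne : (dedekindZeta_residue K : ℂ) ≠ 0 := by
    exact_mod_cast dedekindZeta_residue_ne_zero K
  filter_upwards [h.eventually_ne hne] with s hs
  by_contra hns
  apply hs
  rw [dedekindZeta, LSeries, tsum_eq_zero_of_not_summable hns, mul_zero]

theorem eventually_idealZeta_ne_top : ∀ᶠ s : ℝ in 𝓝[>] 1, idealZeta K s ≠ ∞ := by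
  filter_upwards [eventually_lseriesSummable K] with s hs using (idealZeta_of_summable K hs).1

theorem idealZeta_two_ne_top : idealZeta K 2 ≠ ∞ := by
  have h2 : ∀ᶠ s : ℝ in 𝓝[>] 1, s < 2 :=
    eventually_nhdsWithin_of_eventually_nhds (eventually_lt_nhds (by norm_num))
  obtain ⟨s, hs, hs2⟩ := ((eventually_lseriesSummable K).and h2).exists
  exact (idealZeta_of_summable K (hs.of_re_le_re (by simpa using hs2.le))).1

theorem tendsto_sub_one_mul_idealZeta :
    Tendsto (fun s : ℝ ↦ (s - 1) * (idealZeta K s).toReal) (𝓝[>] 1)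
      (𝓝 (dedekindZeta_residue K)) := by
  have h := tendsto_sub_one_mul_dedekindZeta_nhdsGT K
  have h' := (Complex.continuous_re.tendsto _).comp h
  rw [Complex.ofReal_re] at h'
  refine h'.congr' ?_
  filter_upwards [eventually_lseriesSummable K] with s hs
  simp only [Function.comp]
  rw [(idealZeta_of_summable K hs).2]
  norm_cast

/-- The completely multiplicative function `I ↦ N(I) ^ (-s)`. -/
noncomputable def normPow (s : ℝ) : Ideal (𝓞 K) →* ℝ≥0∞ where
  toFun I := (Ideal.absNorm I : ℝ≥0∞) ^ (-s)
  map_one' := by simp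
  map_mul' I J := by
    rw [map_mul, Nat.cast_mul,
      ENNReal.mul_rpow_of_ne_top (ENNReal.natCast_ne_top _) (ENNReal.natCast_ne_top _)]

theorem normPow_apply (s : ℝ) (I : Ideal (𝓞 K)) :
    normPow K s I = (Ideal.absNorm I : ℝ≥0∞) ^ (-s) := rfl

theorem normPow_sq (s : ℝ) (I : Ideal (𝓞 K)) : normPow K s (I ^ 2) = normPow K (2 * s) I := by
  rw [normPow_apply, normPow_apply, map_pow, Nat.cast_pow, ← ENNReal.rpow_natCast,
    ← ENNReal.rpow_mul]
  congr 1
  push_cast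
  ring

variable {K}

theorem one_le_absNorm {I : Ideal (𝓞 K)} (hI : I ≠ 0) : (1 : ℝ≥0∞) ≤ Ideal.absNorm I := by
  exact_mod_cast Nat.one_le_iff_ne_zero.2 (fun h ↦ hI (Ideal.absNorm_eq_zero_iff.1 h))

theorem normPow_le_one {s : ℝ} (hs : 0 < s) {I : Ideal (𝓞 K)} (hI : I ≠ 0) : normPow K s I ≤ 1 := by
  rw [normPow_apply, ENNReal.rpow_neg]
  exact ENNReal.inv_le_one.2 (ENNReal.one_le_rpow (one_le_absNorm hI) hs)

theorem normPow_anti {s t : ℝ} (hst : s ≤ t) {I : Ideal (𝓞 K)} (hI : I ≠ 0) :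
    normPow K t I ≤ normPow K s I :=
  ENNReal.rpow_le_rpow_of_exponent_le (one_le_absNorm hI) (neg_le_neg hst)

theorem exists_eq_prod_mul_sq {I : Ideal (𝓞 K)} (hI : I ≠ 0) :
    ∃ (S : Finset (HeightOneSpectrum (𝓞 K))) (J : {J : Ideal (𝓞 K) // J ≠ 0}),
      I = (∏ P ∈ S, P.asIdeal) * J.1 ^ 2 := by
  classical
  induction I using UniqueFactorizationMonoid.induction_on_prime with
  | h₁ => exact absurd rfl hI
  | h₂ I hu => exact ⟨∅, ⟨1, one_ne_zero⟩, by
      rw [Finset.prod_empty, one_mul, one_pow, Ideal.one_eq_top, Ideal.isUnit_iff.1 hu]⟩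
  | h₃ I p hI0 hp ih =>
    obtain ⟨S, J, rfl⟩ := ih hI0
    let P : HeightOneSpectrum (𝓞 K) := ⟨p, Ideal.isPrime_of_prime hp, hp.ne_zero⟩
    by_cases hP : P ∈ S
    · refine ⟨S.erase P, ⟨p * J.1, mul_ne_zero hp.ne_zero J.2⟩, ?_⟩
      rw [← Finset.mul_prod_erase S _ hP]
      simp only [P]
      ring
    · refine ⟨insert P S, J, ?_⟩
      rw [Finset.prod_insert hP]
      simp only [P]
      ring

theorem prod_asIdeal_ne_zero {F : Type*} [Field F] (S : Finset (HeightOneSpectrum (𝓞 F))) :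
    ∏ P ∈ S, P.asIdeal ≠ 0 := Finset.prod_ne_zero_iff.2 fun P _ ↦ P.ne_bot

theorem idealZeta_le_tsum_finset_mul (s : ℝ) : idealZeta K s ≤
    (∑' S : Finset (HeightOneSpectrum (𝓞 K)), ∏ P ∈ S, normPow K s P.asIdeal) *
      idealZeta K (2 * s) := by
  let f : Finset (HeightOneSpectrum (𝓞 K)) × {J : Ideal (𝓞 K) // J ≠ 0} →
      {I : Ideal (𝓞 K) // I ≠ 0} := fun x ↦
    ⟨(∏ P ∈ x.1, P.asIdeal) * x.2.1 ^ 2,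
      mul_ne_zero (prod_asIdeal_ne_zero _) (pow_ne_zero _ x.2.2)⟩
  have hf : Function.Surjective f := by
    rintro ⟨I, hI⟩
    obtain ⟨S, J, h⟩ := exists_eq_prod_mul_sq hI
    exact ⟨(S, J), Subtype.ext h.symm⟩
  refine (ENNReal.tsum_le_tsum_comp_of_surjective hf (fun I ↦ normPow K s I.1)).trans ?_
  rw [ENNReal.tsum_prod', ← ENNReal.tsum_mul_right]
  refine ENNReal.tsum_le_tsum fun S ↦ ?_
  rw [idealZeta, ← ENNReal.tsum_mul_left]
  refine ENNReal.tsum_le_tsum fun J ↦ ?_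
  simp only [f]
  rw [map_mul, map_prod, normPow_sq]
  rfl

theorem tsum_finset_prod_le_exp {ι : Type*} (x : ι → ℝ≥0∞) (hx : ∑' i, x i ≠ ∞) :
    ∑' S : Finset ι, ∏ i ∈ S, x i ≤ ENNReal.ofReal (Real.exp (∑' i, x i).toReal) := by
  classical
  rw [ENNReal.tsum_eq_iSup_sum]
  refine iSup_le fun T ↦ ?_
  have hfin : ∀ i, x i ≠ ∞ := ENNReal.ne_top_of_tsum_ne_top hx
  calc ∑ S ∈ T, ∏ i ∈ S, x i
      ≤ ∑ S ∈ (T.biUnion id).powerset, ∏ i ∈ S, x i :=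
        Finset.sum_le_sum_of_subset fun S hS ↦
          Finset.mem_powerset.2 (Finset.subset_biUnion_of_mem id hS)
    _ = ∏ i ∈ T.biUnion id, (1 + x i) := (Finset.prod_one_add _).symm
    _ ≤ ∏ i ∈ T.biUnion id, ENNReal.ofReal (Real.exp (x i).toReal) := by
        refine Finset.prod_le_prod' fun i _ ↦ ?_
        rw [← ENNReal.ofReal_toReal (hfin i), ← ENNReal.ofReal_one,
          ← ENNReal.ofReal_add zero_le_one ENNReal.toReal_nonneg,
          ENNReal.toReal_ofReal ENNReal.toReal_nonneg, add_comm]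
        exact ENNReal.ofReal_le_ofReal (Real.add_one_le_exp _)
    _ = ENNReal.ofReal (Real.exp (∑ i ∈ T.biUnion id, x i).toReal) := by
        rw [← ENNReal.ofReal_prod_of_nonneg (fun _ _ ↦ (Real.exp_pos _).le), ← Real.exp_sum,
          ENNReal.toReal_sum (fun i _ ↦ hfin i)]
    _ ≤ _ := by
        refine ENNReal.ofReal_le_ofReal (Real.exp_le_exp.2 ?_)
        exact ENNReal.toReal_mono hx (ENNReal.sum_le_tsum _)

theorem idealZeta_anti {s t : ℝ} (hst : s ≤ t) : idealZeta K t ≤ idealZeta K s :=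
  ENNReal.tsum_le_tsum fun I ↦ normPow_anti hst I.2

theorem primeZeta_le_idealZeta (s : ℝ) : primeZeta K s ≤ idealZeta K s :=
  ENNReal.tsum_comp_le_tsum_of_injective (f := fun P : HeightOneSpectrum (𝓞 K) ↦
    (⟨P.asIdeal, P.ne_bot⟩ : {I : Ideal (𝓞 K) // I ≠ 0}))
    (fun _ _ h ↦ HeightOneSpectrum.ext (congrArg Subtype.val h)) (fun I ↦ normPow K s I.1)

theorem idealZeta_le_exp {s : ℝ} (hs : 1 ≤ s) (h : primeZeta K s ≠ ∞) :
    idealZeta K s ≤ ENNReal.ofReal (Real.exp (primeZeta K s).toReal) * idealZeta K 2 :=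
  (idealZeta_le_tsum_finset_mul s).trans
    (mul_le_mul' (tsum_finset_prod_le_exp _ h) (idealZeta_anti (by linarith)))

theorem prod_asIdeal_injective :
    Function.Injective fun S : Finset (HeightOneSpectrum (𝓞 K)) ↦ ∏ P ∈ S, P.asIdeal := by
  have key : ∀ S T : Finset (HeightOneSpectrum (𝓞 K)),
      ∏ P ∈ S, P.asIdeal = ∏ P ∈ T, P.asIdeal → S ⊆ T := by
    intro S T h P hP
    have hd : P.asIdeal ∣ ∏ Q ∈ T, Q.asIdeal := h ▸ Finset.dvd_prod_of_mem _ hP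
    obtain ⟨Q, hQ, hPQ⟩ := (Prime.dvd_finsetProd_iff P.prime _).1 hd
    have : Q.asIdeal = P.asIdeal :=
      (Q.isMaximal.eq_of_le P.isPrime.ne_top (Ideal.dvd_iff_le.1 hPQ))
    rwa [← HeightOneSpectrum.ext this]
  exact fun S T h ↦ (key S T h).antisymm (key T S h.symm)

theorem prod_one_add_le_idealZeta (s : ℝ) (U : Finset (HeightOneSpectrum (𝓞 K))) :
    ∏ P ∈ U, (1 + normPow K s P.asIdeal) ≤ idealZeta K s := by
  rw [Finset.prod_one_add]
  refine (ENNReal.sum_le_tsum _).trans ?_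
  simp_rw [← map_prod]
  exact ENNReal.tsum_comp_le_tsum_of_injective (f := fun S : Finset (HeightOneSpectrum (𝓞 K)) ↦
    (⟨∏ P ∈ S, P.asIdeal, prod_asIdeal_ne_zero S⟩ : {I : Ideal (𝓞 K) // I ≠ 0}))
    (fun _ _ h ↦ prod_asIdeal_injective (congrArg Subtype.val h)) (fun I ↦ normPow K s I.1)

theorem Real.exp_le_one_add_mul_one_add_sq {x : ℝ} (h0 : 0 ≤ x) (h1 : x ≤ 1) :
    Real.exp x ≤ (1 + x) * (1 + x ^ 2) := by
  have h := Real.abs_exp_sub_one_sub_id_le (x := x) (by rwa [abs_of_nonneg h0])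
  have := (abs_le.1 h).2
  nlinarith [pow_nonneg h0 3]

theorem exp_sum_le_idealZeta {s : ℝ} (hs : 1 ≤ s) (U : Finset (HeightOneSpectrum (𝓞 K))) :
    ENNReal.ofReal (Real.exp (∑ P ∈ U, normPow K s P.asIdeal).toReal) ≤
      idealZeta K s * idealZeta K 2 := by
  have hle : ∀ P : HeightOneSpectrum (𝓞 K), normPow K s P.asIdeal ≤ 1 := fun P ↦
    normPow_le_one (by linarith) P.ne_bot
  have hfin : ∀ P : HeightOneSpectrum (𝓞 K), normPow K s P.asIdeal ≠ ∞ := fun P ↦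
    ne_top_of_le_ne_top ENNReal.one_ne_top (hle P)
  rw [ENNReal.toReal_sum (fun i _ ↦ hfin i), Real.exp_sum,
    ENNReal.ofReal_prod_of_nonneg (fun _ _ ↦ (Real.exp_pos _).le)]
  calc ∏ P ∈ U, ENNReal.ofReal (Real.exp (normPow K s P.asIdeal).toReal)
      ≤ ∏ P ∈ U, ((1 + normPow K s P.asIdeal) * (1 + normPow K (2 * s) P.asIdeal)) := by
        refine Finset.prod_le_prod' fun P _ ↦ ?_
        have h1 : (normPow K s P.asIdeal).toReal ≤ 1 := by
          simpa using ENNReal.toReal_mono ENNReal.one_ne_top (hle P)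
        refine (ENNReal.ofReal_le_ofReal
          (Real.exp_le_one_add_mul_one_add_sq ENNReal.toReal_nonneg h1)).trans_eq ?_
        have h0 := ENNReal.toReal_nonneg (a := normPow K s P.asIdeal)
        rw [ENNReal.ofReal_mul (by positivity), ENNReal.ofReal_add zero_le_one h0,
          ENNReal.ofReal_add zero_le_one (by positivity), ENNReal.ofReal_pow h0,
          ENNReal.ofReal_toReal (hfin P), ENNReal.ofReal_one, ← map_pow, normPow_sq]
    _ = (∏ P ∈ U, (1 + normPow K s P.asIdeal)) * ∏ P ∈ U, (1 + normPow K (2 * s) P.asIdeal) :=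
        Finset.prod_mul_distrib
    _ ≤ idealZeta K s * idealZeta K (2 * s) :=
        mul_le_mul' (prod_one_add_le_idealZeta _ _) (prod_one_add_le_idealZeta _ _)
    _ ≤ _ := mul_le_mul' le_rfl (idealZeta_anti (by linarith))

theorem exp_primeZeta_le {s : ℝ} (hs : 1 ≤ s) (h : primeZeta K s ≠ ∞) :
    ENNReal.ofReal (Real.exp (primeZeta K s).toReal) ≤ idealZeta K s * idealZeta K 2 := by
  have ht : Tendsto (fun U : Finset (HeightOneSpectrum (𝓞 K)) ↦
      ∑ P ∈ U, normPow K s P.asIdeal) atTop (𝓝 (primeZeta K s)) :=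
    ENNReal.summable.hasSum
  have ht' := ENNReal.tendsto_ofReal
    ((Real.continuous_exp.tendsto _).comp ((ENNReal.tendsto_toReal h).comp ht))
  exact le_of_tendsto' ht' fun U ↦ exp_sum_le_idealZeta hs U

/-- The residue characteristic of a nonzero prime ideal. -/
noncomputable def resChar (P : HeightOneSpectrum (𝓞 K)) : ℕ := Ideal.absNorm (P.asIdeal.under ℤ)

theorem resChar_prime {F : Type*} [Field F] (P : HeightOneSpectrum (𝓞 F)) : (resChar P).Prime := by
  have := P.isPrime
  have : NeZero P.asIdeal := ⟨P.ne_bot⟩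
  exact Nat.absNorm_under_prime P.asIdeal

instance liesOver_resChar (P : HeightOneSpectrum (𝓞 K)) :
    P.asIdeal.LiesOver (Ideal.span {(resChar P : ℤ)}) :=
  Int.liesOver_span_absNorm P.asIdeal

theorem absNorm_eq_resChar_pow (P : HeightOneSpectrum (𝓞 K)) :
    ∃ f ≠ 0, Ideal.absNorm P.asIdeal = resChar P ^ f := by
  have := P.isPrime
  refine ⟨P.asIdeal.inertiaDeg ℤ, ?_, (Ideal.pow_inertiaDeg (resChar P) P.asIdeal).symm⟩
  intro h
  have h1 := Ideal.pow_inertiaDeg (resChar P) P.asIdeal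
  rw [h, pow_zero] at h1
  exact P.isPrime.ne_top (Ideal.absNorm_eq_one_iff.1 h1.symm)

theorem resChar_eq_of_absNorm_eq {P : HeightOneSpectrum (𝓞 K)} {p : ℕ} (hp : p.Prime)
    (h : Ideal.absNorm P.asIdeal = p) : resChar P = p := by
  obtain ⟨f, hf, hP⟩ := absNorm_eq_resChar_pow P
  rw [h] at hP
  exact ((Nat.prime_dvd_prime_iff_eq (resChar_prime P) hp).1 (hP ▸ dvd_pow_self _ hf))

theorem card_resChar_fiber_le {p : ℕ} (hp : p.Prime) :
    Finite ((resChar : HeightOneSpectrum (𝓞 K) → ℕ) ⁻¹' {p}) ∧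
      Nat.card ((resChar : HeightOneSpectrum (𝓞 K) → ℕ) ⁻¹' {p}) ≤ Module.finrank ℚ K := by
  have hp0 : Ideal.span {(p : ℤ)} ≠ ⊥ := by simpa using hp.ne_zero
  have : (Ideal.span {(p : ℤ)}).IsPrime :=
    (Ideal.span_singleton_prime (by exact_mod_cast hp.ne_zero)).2 (Nat.prime_iff_prime_int.1 hp)
  have : (Ideal.span {(p : ℤ)}).IsMaximal := this.isMaximal hp0
  have hfin : Finite ((Ideal.span {(p : ℤ)}).primesOver (𝓞 K)) :=
    (IsDedekindDomain.primesOver_finite (Ideal.span {(p : ℤ)}) (𝓞 K)).to_subtype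
  have := Fintype.ofFinite ((Ideal.span {(p : ℤ)}).primesOver (𝓞 K))
  let f : (resChar : HeightOneSpectrum (𝓞 K) → ℕ) ⁻¹' {p} →
      (Ideal.span {(p : ℤ)}).primesOver (𝓞 K) := fun P ↦
    ⟨P.1.asIdeal, P.1.isPrime, by
      have h : resChar P.1 = p := P.2
      have h2 := liesOver_resChar P.1
      rwa [h] at h2⟩
  have hf : Function.Injective f := fun P Q h ↦
    Subtype.ext (HeightOneSpectrum.ext (congrArg Subtype.val h))
  refine ⟨Finite.of_injective f hf, (Nat.card_le_card_of_injective f hf).trans ?_⟩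
  rw [← RingOfIntegers.rank K, ←
    Ideal.sum_ramification_inertia_eq_finrank (Ideal.span {(p : ℤ)}) (𝓞 K),
    Nat.card_eq_fintype_card, Fintype.card_eq_sum_ones]
  refine Finset.sum_le_sum fun Q _ ↦ ?_
  have := Q.2.1
  have := Q.2.2
  exact Nat.one_le_iff_ne_zero.2
    (mul_pos (Q.1.ramificationIdx_pos ℤ) (Q.1.inertiaDeg_pos ℤ)).ne'

theorem tsum_fiber_le {p : ℕ} (hp : p.Prime) (x : HeightOneSpectrum (𝓞 K) → ℝ≥0∞) (c : ℝ≥0∞)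
    (hx : ∀ P, resChar P = p → x P ≤ c) :
    ∑' P : (resChar : HeightOneSpectrum (𝓞 K) → ℕ) ⁻¹' {p}, x P ≤ Module.finrank ℚ K * c := by
  obtain ⟨hfin, hcard⟩ := card_resChar_fiber_le (K := K) hp
  refine (ENNReal.tsum_le_tsum
    fun P : (resChar : HeightOneSpectrum (𝓞 K) → ℕ) ⁻¹' {p} ↦ hx P.1 P.2).trans ?_
  rw [ENNReal.tsum_const, ENat.card_eq_coe_natCard]
  gcongr
  exact_mod_cast hcard

variable (L : Type*) [Field L] [NumberField L]

theorem two_mul_tsum_fiber_le {B : Finset ℕ}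
    (h : ∀ p : ℕ, p.Prime → p ∉ B →
      (∃ P : HeightOneSpectrum (𝓞 K), Ideal.absNorm P.asIdeal = p) →
      ∃ T : Finset (HeightOneSpectrum (𝓞 L)), (∀ Q ∈ T, Ideal.absNorm Q.asIdeal = p) ∧
        2 * Module.finrank ℚ K ≤ T.card) {s : ℝ} (hs : 1 ≤ s) (p : ℕ) :
    2 * ∑' P : (resChar : HeightOneSpectrum (𝓞 K) → ℕ) ⁻¹' {p}, normPow K s P.1.asIdeal ≤
      ∑' Q : (resChar : HeightOneSpectrum (𝓞 L) → ℕ) ⁻¹' {p}, normPow L s Q.1.asIdeal +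
        2 * Module.finrank ℚ K * ((p : ℝ≥0∞) ^ (-2 : ℝ) + if p ∈ B then 1 else 0) := by
  by_cases hp : p.Prime
  swap
  · have : IsEmpty ((resChar : HeightOneSpectrum (𝓞 K) → ℕ) ⁻¹' {p}) :=
      ⟨fun P ↦ hp ((show resChar P.1 = p from P.2) ▸ resChar_prime P.1)⟩
    simp
  have hp1 : (1 : ℝ≥0∞) ≤ p := by exact_mod_cast hp.one_le
  by_cases hB : p ∈ B
  · rw [if_pos hB]
    refine le_add_left ?_
    rw [mul_assoc]
    gcongr
    refine (tsum_fiber_le hp (fun P ↦ normPow K s P.asIdeal) 1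
      fun P _ ↦ normPow_le_one (by linarith) P.ne_bot).trans ?_
    gcongr
    exact le_add_self
  by_cases hP : ∃ P : HeightOneSpectrum (𝓞 K), Ideal.absNorm P.asIdeal = p
  · refine le_add_right ?_
    obtain ⟨T, hT, hcard⟩ := h p hp hB hP
    calc _ ≤ 2 * (Module.finrank ℚ K * (p : ℝ≥0∞) ^ (-s)) := by
          gcongr
          refine tsum_fiber_le hp (fun P ↦ normPow K s P.asIdeal) _ fun P hPp ↦ ?_
          obtain ⟨f, hf, hPf⟩ := absNorm_eq_resChar_pow P
          rw [normPow_apply, hPf, hPp, ENNReal.rpow_neg, ENNReal.rpow_neg, ENNReal.inv_le_inv]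
          refine ENNReal.rpow_le_rpow ?_ (by linarith)
          exact_mod_cast Nat.le_self_pow hf p
      _ ≤ T.card * (p : ℝ≥0∞) ^ (-s) := by
          rw [← mul_assoc]
          gcongr
          exact_mod_cast hcard
      _ = ∑ Q ∈ T.attach, (normPow L s Q.1.asIdeal) := by
          rw [Finset.sum_attach T (fun Q ↦ normPow L s Q.asIdeal),
            Finset.sum_congr rfl (fun Q hQ ↦ by rw [normPow_apply, hT Q hQ]), Finset.sum_const,
            nsmul_eq_mul]
      _ ≤ ∑' Q : T, (normPow L s Q.1.asIdeal) := ENNReal.sum_le_tsum _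
      _ ≤ _ := ENNReal.tsum_comp_le_tsum_of_injective
          (f := fun Q : T ↦ (⟨Q.1, resChar_eq_of_absNorm_eq hp (hT Q.1 Q.2)⟩ :
            (resChar : HeightOneSpectrum (𝓞 L) → ℕ) ⁻¹' {p}))
          (fun _ _ h ↦ Subtype.ext (Subtype.mk.inj h)) (fun Q ↦ normPow L s Q.1.asIdeal)
  · refine le_add_left ?_
    rw [if_neg hB, add_zero, mul_assoc]
    gcongr
    refine tsum_fiber_le hp (fun P ↦ normPow K s P.asIdeal) _ fun P hPp ↦ ?_
    obtain ⟨f, hf, hPf⟩ := absNorm_eq_resChar_pow P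
    have hf2 : 2 ≤ f := by
      rcases Nat.lt_or_ge f 2 with h2 | h2
      · have : f = 1 := by omega
        subst this
        exact absurd ⟨P, by rw [hPf, hPp, pow_one]⟩ hP
      · exact h2
    rw [normPow_apply, hPf, hPp, Nat.cast_pow, ← ENNReal.rpow_natCast, ← ENNReal.rpow_mul]
    refine ENNReal.rpow_le_rpow_of_exponent_le hp1 ?_
    have : (2 : ℝ) ≤ f := by exact_mod_cast hf2
    nlinarith

theorem primeZeta_eq_tsum_fiber (F : Type*) [Field F] [NumberField F] (s : ℝ) :
    primeZeta F s = ∑' p : {p : ℕ // p ≠ 0},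
      ∑' P : (resChar : HeightOneSpectrum (𝓞 F) → ℕ) ⁻¹' {p.1}, normPow F s P.1.asIdeal := by
  have := ENNReal.tsum_fiberwise (fun P : HeightOneSpectrum (𝓞 F) ↦ normPow F s P.asIdeal)
    (fun P ↦ (⟨resChar P, (resChar_prime P).ne_zero⟩ : {p : ℕ // p ≠ 0}))
  rw [primeZeta]
  refine this.symm.trans (tsum_congr fun p ↦ ?_)
  have hp : (fun P : HeightOneSpectrum (𝓞 F) ↦
      (⟨resChar P, (resChar_prime P).ne_zero⟩ : {p : ℕ // p ≠ 0})) ⁻¹' {p} = resChar ⁻¹' {p.1} := by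
    ext
    simp [Subtype.ext_iff]
  rw [hp]

theorem exists_two_mul_primeZeta_le {B : Finset ℕ}
    (h : ∀ p : ℕ, p.Prime → p ∉ B →
      (∃ P : HeightOneSpectrum (𝓞 K), Ideal.absNorm P.asIdeal = p) →
      ∃ T : Finset (HeightOneSpectrum (𝓞 L)), (∀ Q ∈ T, Ideal.absNorm Q.asIdeal = p) ∧
        2 * Module.finrank ℚ K ≤ T.card) :
    ∃ C : ℝ≥0∞, C ≠ ∞ ∧ ∀ s : ℝ, 1 ≤ s → 2 * primeZeta K s ≤ primeZeta L s + C := by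
  refine ⟨∑' p : {p : ℕ // p ≠ 0},
    2 * Module.finrank ℚ K * ((p.1 : ℝ≥0∞) ^ (-2 : ℝ) + if p.1 ∈ B then 1 else 0), ?_, ?_⟩
  · rw [ENNReal.tsum_mul_left]
    refine ENNReal.mul_ne_top (ENNReal.mul_ne_top (by simp) (by simp)) ?_
    rw [ENNReal.tsum_add]
    refine ENNReal.add_ne_top.2 ⟨?_, ?_⟩
    · have hs : Summable fun n : ℕ ↦ (n : ℝ) ^ (-2 : ℝ) := Real.summable_nat_rpow.2 (by norm_num)
      refine ne_top_of_le_ne_top (hs.tsum_ofReal_ne_top) ?_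
      refine le_trans (ENNReal.tsum_le_tsum fun p ↦ ?_)
        (ENNReal.tsum_comp_le_tsum_of_injective (f := ((↑) : {p : ℕ // p ≠ 0} → ℕ))
          Subtype.val_injective (fun n : ℕ ↦ ENNReal.ofReal ((n : ℝ) ^ (-2 : ℝ))))
      have : (0 : ℝ) < p.1 := by exact_mod_cast Nat.pos_of_ne_zero p.2
      rw [← ENNReal.ofReal_rpow_of_pos this, ENNReal.ofReal_natCast]
    · refine ne_top_of_le_ne_top (b := ∑' p : ℕ, if p ∈ B then 1 else 0) ?_
        (ENNReal.tsum_comp_le_tsum_of_injective (f := ((↑) : {p : ℕ // p ≠ 0} → ℕ))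
          Subtype.val_injective (fun n : ℕ ↦ if n ∈ B then 1 else 0))
      rw [tsum_eq_sum (s := B) (fun b hb ↦ if_neg hb)]
      simp
  · intro s hs
    rw [primeZeta_eq_tsum_fiber K, primeZeta_eq_tsum_fiber L, ← ENNReal.tsum_mul_left,
      ← ENNReal.tsum_add]
    exact ENNReal.tsum_le_tsum fun p ↦ two_mul_tsum_fiber_le L h hs p.1

theorem primeZeta_compare_false {B : Finset ℕ}
    (h : ∀ p : ℕ, p.Prime → p ∉ B →
      (∃ P : HeightOneSpectrum (𝓞 K), Ideal.absNorm P.asIdeal = p) →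
      ∃ T : Finset (HeightOneSpectrum (𝓞 L)), (∀ Q ∈ T, Ideal.absNorm Q.asIdeal = p) ∧
        2 * Module.finrank ℚ K ≤ T.card) : False := by
  obtain ⟨C, hC, hW⟩ := exists_two_mul_primeZeta_le L h
  set M : ℝ := (idealZeta K 2).toReal ^ 2 * Real.exp C.toReal * (idealZeta L 2).toReal
  have hbound : ∀ᶠ s : ℝ in 𝓝[>] 1, (idealZeta K s).toReal ^ 2 ≤ M * (idealZeta L s).toReal := by
    filter_upwards [eventually_idealZeta_ne_top K, eventually_idealZeta_ne_top L,
      self_mem_nhdsWithin] with s hK hL hs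
    have hs : 1 ≤ s := le_of_lt hs
    have hK' := ne_top_of_le_ne_top hK (primeZeta_le_idealZeta s)
    have hL' := ne_top_of_le_ne_top hL (primeZeta_le_idealZeta s)
    have h1 := ENNReal.toReal_mono
      (ENNReal.mul_ne_top ENNReal.ofReal_ne_top (idealZeta_two_ne_top K)) (idealZeta_le_exp hs hK')
    have h2 := ENNReal.toReal_mono (ENNReal.mul_ne_top hL (idealZeta_two_ne_top L))
      (exp_primeZeta_le hs hL')
    have h3 := ENNReal.toReal_mono (ENNReal.add_ne_top.2 ⟨hL', hC⟩) (hW s hs)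
    rw [ENNReal.toReal_mul, ENNReal.toReal_ofReal (Real.exp_nonneg _)] at h1
    rw [ENNReal.toReal_mul, ENNReal.toReal_ofReal (Real.exp_nonneg _)] at h2
    rw [ENNReal.toReal_mul, ENNReal.toReal_add hL' hC, ENNReal.toReal_ofNat] at h3
    calc (idealZeta K s).toReal ^ 2
        ≤ (Real.exp (primeZeta K s).toReal * (idealZeta K 2).toReal) ^ 2 := by gcongr
      _ = Real.exp (2 * (primeZeta K s).toReal) * (idealZeta K 2).toReal ^ 2 := by
          rw [mul_pow, ← Real.exp_nat_mul, Nat.cast_ofNat]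
      _ ≤ Real.exp ((primeZeta L s).toReal + C.toReal) * (idealZeta K 2).toReal ^ 2 := by gcongr
      _ = Real.exp (primeZeta L s).toReal * (Real.exp C.toReal * (idealZeta K 2).toReal ^ 2) := by
          rw [Real.exp_add, mul_assoc]
      _ ≤ ((idealZeta L s).toReal * (idealZeta L 2).toReal) *
          (Real.exp C.toReal * (idealZeta K 2).toReal ^ 2) := by gcongr
      _ = M * (idealZeta L s).toReal := by ring
  have hlim : Tendsto (fun s : ℝ ↦ s - 1) (𝓝[>] 1) (𝓝 0) := by
    refine Tendsto.mono_left ?_ nhdsWithin_le_nhds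
    simpa using (tendsto_id (α := ℝ) (x := 𝓝 1)).sub_const 1
  have h0 : (dedekindZeta_residue K) ^ 2 ≤ 0 * (M * dedekindZeta_residue L) := by
    refine le_of_tendsto_of_tendsto ((tendsto_sub_one_mul_idealZeta K).pow 2)
      (hlim.mul ((tendsto_sub_one_mul_idealZeta L).const_mul M)) ?_
    filter_upwards [hbound, self_mem_nhdsWithin] with s hs h1
    have : 0 ≤ (s - 1) ^ 2 := sq_nonneg _
    calc _ = (s - 1) ^ 2 * (idealZeta K s).toReal ^ 2 := by ring
      _ ≤ (s - 1) ^ 2 * (M * (idealZeta L s).toReal) := by gcongr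
      _ = _ := by ring
  have := pow_pos (dedekindZeta_residue_pos K) 2
  linarith

end Zeta

section SplitPrimes

open Pointwise

theorem eq_of_pow_eq_of_sub_mem {R : Type*} [CommRing R] [IsDomain R] {Q : Ideal R} [Q.IsPrime]
    {x y : R} {m : ℕ} (h : x ^ m = y ^ m) (hxy : x - y ∈ Q) (hm : (m : R) ∉ Q)
    (hy : y ^ m ∉ Q) : x = y := by
  have hm0 : m ≠ 0 := by
    rintro rfl
    simp at hm
  have hmul : (∑ i ∈ Finset.range m, x ^ i * y ^ (m - 1 - i)) * (x - y) = 0 := by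
    rw [(Commute.all x y).geom_sum₂_mul, h, sub_self]
  refine sub_eq_zero.1 ((mul_eq_zero.1 hmul).resolve_left fun h0 ↦ ?_)
  have hq : Ideal.Quotient.mk Q x = Ideal.Quotient.mk Q y := Ideal.Quotient.eq.2 hxy
  have h1 := congrArg (Ideal.Quotient.mk Q) h0
  simp only [map_sum, map_mul, map_pow, map_zero, hq] at h1
  rw [Finset.sum_congr rfl (g := fun _ ↦ Ideal.Quotient.mk Q y ^ (m - 1)) fun i hi ↦ by
    rw [← pow_add, Nat.add_sub_cancel' (Nat.le_sub_one_of_lt (Finset.mem_range.1 hi))]] at h1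
  rw [Finset.sum_const, Finset.card_range, nsmul_eq_mul, ← map_natCast (Ideal.Quotient.mk Q),
    ← map_pow, ← map_mul, Ideal.Quotient.eq_zero_iff_mem] at h1
  refine (‹Q.IsPrime›.mem_or_mem h1).elim hm fun h2 ↦ hy ?_
  rw [← Nat.sub_add_cancel (Nat.one_le_iff_ne_zero.2 hm0), pow_succ]
  exact Ideal.mul_mem_right _ _ h2

theorem card_le_of_pow_eq_self {R : Type*} [CommRing R] [IsDomain R] [Finite R] {p : ℕ}
    (hp : 1 < p) (h : ∀ z : R, z ^ p = z) : Nat.card R ≤ p := by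
  classical
  have := Fintype.ofFinite R
  have hdeg : (Polynomial.X ^ p - Polynomial.X : Polynomial R).natDegree = p := by
    compute_degree!
    · simp [hp.ne]
    · omega
  have hne : (Polynomial.X ^ p - Polynomial.X : Polynomial R) ≠ 0 := by
    intro h0
    rw [h0, Polynomial.natDegree_zero] at hdeg
    omega
  rw [Nat.card_eq_fintype_card]
  calc Fintype.card R
      ≤ (Polynomial.X ^ p - Polynomial.X : Polynomial R).roots.toFinset.card := by
        refine Finset.card_le_card fun z _ ↦ ?_
        simp [hne, h]
    _ ≤ (Polynomial.X ^ p - Polynomial.X : Polynomial R).natDegree :=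
        (Multiset.toFinset_card_le _).trans (Polynomial.card_roots' _)
    _ = p := hdeg

variable {L : Type*} [Field L] [NumberField L]

/-- `S` generates `L` by `m`-th roots of integers prime to `p` which are fixed by the `p`-power map
modulo `p`. -/
structure IsKummerFixed (p : ℕ) (S : Set (𝓞 L)) : Prop where
  adjoin_eq_top : IntermediateField.adjoin ℚ (((↑) : 𝓞 L → L) '' S) = ⊤
  pow_eq : ∀ x ∈ S, ∃ (m : ℕ) (c : ℤ), x ^ m = c ∧ ¬ p ∣ m ∧ ¬ (p : ℤ) ∣ c
  pow_sub : ∀ x ∈ S, (p : 𝓞 L) ∣ x ^ p - x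

theorem intCast_mem_iff {F : Type*} [Field F] {p : ℕ} (Q : Ideal (𝓞 F))
    [hQ : Q.LiesOver (Ideal.span {(p : ℤ)})] (c : ℤ) :
    (c : 𝓞 F) ∈ Q ↔ (p : ℤ) ∣ c := by
  rw [← Ideal.mem_span_singleton, hQ.over, Ideal.mem_comap]
  simp

theorem IsKummerFixed.eq_one {p : ℕ} {S : Set (𝓞 L)} (hS : IsKummerFixed p S) (Q : Ideal (𝓞 L))
    [Q.IsPrime] [hQ : Q.LiesOver (Ideal.span {(p : ℤ)})] {σ : Gal(L/ℚ)}
    (hσ : ∀ x ∈ S, σ • x - x ∈ Q) : σ = 1 := by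
  have hfix : ∀ x ∈ S, σ • x = x := fun x hx ↦ by
    obtain ⟨m, c, hm, hpm, hpc⟩ := hS.pow_eq x hx
    refine eq_of_pow_eq_of_sub_mem (m := m) ?_ (hσ x hx) ?_ ?_
    · rw [← smul_pow', hm]
      exact map_intCast (MulSemiringAction.toRingHom Gal(L/ℚ) (𝓞 L) σ) c
    · have := intCast_mem_iff (p := p) Q m
      rw [Int.cast_natCast] at this
      rw [this]
      exact_mod_cast hpm
    · rwa [hm, intCast_mem_iff (p := p)]
  have h : ∀ x ∈ IntermediateField.adjoin ℚ (((↑) : 𝓞 L → L) '' S), σ • x = x := by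
    rw [IntermediateField.forall_mem_adjoin_smul_eq_self_iff]
    rintro _ ⟨x, hx, rfl⟩
    exact congrArg ((↑) : 𝓞 L → L) (hfix x hx)
  rw [hS.adjoin_eq_top] at h
  exact AlgEquiv.ext fun x ↦ h x trivial

theorem IsKummerFixed.smul_eq_self [IsGalois ℚ L] {p : ℕ} (hp : p.Prime) {S : Set (𝓞 L)}
    (hS : IsKummerFixed p S) (Q : Ideal (𝓞 L))
    [hQP : Q.IsPrime] [hQ : Q.LiesOver (Ideal.span {(p : ℤ)})] :
    Ideal.absNorm Q = p ∧ ∀ σ : Gal(L/ℚ), σ • Q = Q → σ = 1 := by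
  have hp0 : Q ≠ ⊥ := by
    rintro rfl
    have := (intCast_mem_iff (p := p) (⊥ : Ideal (𝓞 L)) p).2 dvd_rfl
    simp [hp.ne_zero] at this
  have : Finite (𝓞 L ⧸ Q) := Ideal.finiteQuotientOfFreeOfNeBot Q hp0
  obtain ⟨σ, hσ⟩ := IsArithFrobAt.exists_of_isInvariant ℤ Gal(L/ℚ) Q
  have hcard : Nat.card (ℤ ⧸ Q.under ℤ) = p := by
    rw [← hQ.over, ← Submodule.cardQuot_apply, ← Ideal.absNorm_apply, Ideal.absNorm_span_singleton]
    simp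
  have hpQ : (p : 𝓞 L) ∈ Q := by exact_mod_cast (intCast_mem_iff (p := p) Q p).2 dvd_rfl
  have hσ' : ∀ x, σ • x - x ^ p ∈ Q := fun x ↦ by
    have := hσ x
    rwa [hcard] at this
  have hσ1 : σ = 1 := hS.eq_one Q fun x hx ↦ by
    have := Q.add_mem (hσ' x) (Q.mem_of_dvd (hS.pow_sub x hx) hpQ)
    simpa using this
  have hfrob : ∀ z : 𝓞 L ⧸ Q, z ^ p = z := fun z ↦ by
    obtain ⟨x, rfl⟩ := Ideal.Quotient.mk_surjective z
    have := hσ' x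
    rw [hσ1, one_smul] at this
    rw [← map_pow]
    exact (Ideal.Quotient.eq.2 this).symm
  have hle : Nat.card (𝓞 L ⧸ Q) ≤ p := card_le_of_pow_eq_self hp.one_lt hfrob
  have hinj : Function.Injective (algebraMap (ℤ ⧸ Q.under ℤ) (𝓞 L ⧸ Q)) :=
    Ideal.algebraMap_quotient_injective
  have hbij : Function.Bijective (algebraMap (ℤ ⧸ Q.under ℤ) (𝓞 L ⧸ Q)) :=
    hinj.bijective_of_nat_card_le (hle.trans hcard.ge)
  refine ⟨?_, fun τ hτ ↦ hS.eq_one Q fun x _ ↦ ?_⟩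
  · rw [Ideal.absNorm_apply, Submodule.cardQuot_apply, ← hcard]
    exact (Nat.card_eq_of_bijective _ hbij).symm
  · obtain ⟨z, hz⟩ := hbij.2 (Ideal.Quotient.mk Q x)
    obtain ⟨k, rfl⟩ := Ideal.Quotient.mk_surjective z
    have hk : (k : 𝓞 L) - x ∈ Q := by
      refine Ideal.Quotient.eq.1 ?_
      rw [← hz]
      simp
    have h2 : τ • ((k : 𝓞 L) - x) ∈ τ • Q := Ideal.smul_mem_pointwise_smul τ _ _ hk
    rw [hτ, smul_sub, show τ • (k : 𝓞 L) = k from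
      map_intCast (MulSemiringAction.toRingHom Gal(L/ℚ) (𝓞 L) τ) k] at h2
    simpa using Q.sub_mem hk h2

theorem IsKummerFixed.exists_finset [IsGalois ℚ L] {p : ℕ} (hp : p.Prime) {S : Set (𝓞 L)}
    (hS : IsKummerFixed p S) : ∃ T : Finset (HeightOneSpectrum (𝓞 L)),
      (∀ Q ∈ T, Ideal.absNorm Q.asIdeal = p) ∧ T.card = Module.finrank ℚ L := by
  classical
  have hp0 : Ideal.span {(p : ℤ)} ≠ ⊥ := by simpa using hp.ne_zero
  have : (Ideal.span {(p : ℤ)}).IsPrime :=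
    (Ideal.span_singleton_prime (by exact_mod_cast hp.ne_zero)).2 (Nat.prime_iff_prime_int.1 hp)
  obtain ⟨Q, hQP, hQ⟩ := Ideal.nonempty_primesOver (S := 𝓞 L) (P := Ideal.span {(p : ℤ)})
  have hover : ∀ σ : Gal(L/ℚ), (σ • Q).LiesOver (Ideal.span {(p : ℤ)}) := fun σ ↦ inferInstance
  have hne : ∀ σ : Gal(L/ℚ), σ • Q ≠ ⊥ := fun σ ↦
    Ideal.ne_bot_of_liesOver_of_ne_bot hp0 _
  let f : Gal(L/ℚ) → HeightOneSpectrum (𝓞 L) := fun σ ↦ ⟨σ • Q, inferInstance, hne σ⟩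
  have hf : Function.Injective f := fun σ τ h ↦ by
    have h1 : σ • Q = τ • Q := congrArg HeightOneSpectrum.asIdeal h
    have h2 := (hS.smul_eq_self hp Q).2 (τ⁻¹ * σ) (by rw [mul_smul, h1, inv_smul_smul])
    exact (inv_mul_eq_one.1 h2).symm
  refine ⟨Finset.univ.image f, ?_, ?_⟩
  · intro P hP
    obtain ⟨σ, -, rfl⟩ := Finset.mem_image.1 hP
    exact (hS.smul_eq_self hp (σ • Q)).1
  · rw [Finset.card_image_of_injective _ hf, Finset.card_univ, ← Nat.card_eq_fintype_card]
    exact IsGalois.card_aut_eq_finrank ℚ L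

end SplitPrimes

section PowerNonresidues

open Polynomial IntermediateField

theorem rat_pow_ne_intCast {q : ℕ} (hq : 0 < q) {n : ℤ} (hn : ∀ b : ℤ, b ^ q ≠ n) (b : ℚ) :
    b ^ q ≠ n := by
  intro hb
  have hint : IsIntegral ℤ b := by
    refine IsIntegral.of_pow hq ?_
    rw [hb]
    exact isIntegral_algebraMap (R := ℤ) (x := n)
  obtain ⟨c, rfl⟩ := IsIntegrallyClosed.isIntegral_iff.1 hint
  refine hn c ?_
  rw [algebraMap_int_eq, eq_intCast] at hb
  exact_mod_cast hb

theorem mem_adjoin_of_minpoly_eq {k L : Type*} [Field k] [Field L] [Algebra k L]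
    [IsAbelianGalois k L] {α β : L} (h : minpoly k α = minpoly k β) : β ∈ k⟮α⟯ := by
  have hsplit := Normal.splits (F := k) (K := k⟮α⟯) inferInstance (AdjoinSimple.gen k α)
  rw [minpoly_gen] at hsplit
  have hβ : β ∈ (minpoly k α).rootSet L := by
    rw [mem_rootSet]
    refine ⟨minpoly.ne_zero (Algebra.IsIntegral.isIntegral α), ?_⟩
    rw [h, minpoly.aeval]
  rw [← hsplit.image_rootSet_algebraMap (B := L)] at hβ
  obtain ⟨z, -, rfl⟩ := hβ
  exact z.2

theorem natDegree_minpoly_dvd_of_mem_adjoin {k L : Type*} [Field k] [Field L] [Algebra k L]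
    [FiniteDimensional k L] {α β : L} (h : β ∈ k⟮α⟯) :
    (minpoly k β).natDegree ∣ (minpoly k α).natDegree := by
  have hdvd := minpoly.degree_dvd (K := k) (x := (⟨β, h⟩ : k⟮α⟯))
    (Algebra.IsIntegral.isIntegral _)
  rwa [minpoly_eq, adjoin.finrank (Algebra.IsIntegral.isIntegral α)] at hdvd

theorem pow_ne_of_isCyclotomicExtension {L : Type*} [Field L] [NumberField L] {q a : ℕ}
    (hq : q.Prime) (ha : a ≠ 0) (h2 : q = 2 → a = 1) [IsCyclotomicExtension {q ^ a} ℚ L] {n : ℤ}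
    (hn : ∀ b : ℤ, b ^ q ≠ n) (α : L) : α ^ q ≠ n := by
  intro hα
  have : NeZero (q ^ a) := ⟨pow_ne_zero _ hq.ne_zero⟩
  have hirr : Irreducible (X ^ q - C (n : ℚ)) :=
    X_pow_sub_C_irreducible_of_prime hq (rat_pow_ne_intCast hq.pos hn)
  have hmin : ∀ β : L, β ^ q = n → minpoly ℚ β = X ^ q - C (n : ℚ) := fun β hβ ↦
    (minpoly.eq_of_irreducible_of_monic hirr (by simp [hβ]) (monic_X_pow_sub_C _ hq.ne_zero)).symm
  by_cases hq2 : q = 2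
  · have hfin := IsCyclotomicExtension.finrank (n := q ^ a) L
      (cyclotomic.irreducible_rat (NeZero.pos (q ^ a)))
    have hdvd := minpoly.degree_dvd (K := ℚ) (x := α) (Algebra.IsIntegral.isIntegral α)
    rw [hmin α hα, natDegree_X_pow_sub_C, hfin, h2 hq2, hq2] at hdvd
    simp at hdvd
  · have : IsAbelianGalois ℚ L := IsCyclotomicExtension.isAbelianGalois {q ^ a} ℚ L
    have hζ := (IsCyclotomicExtension.zeta_spec (q ^ a) ℚ L).pow (NeZero.pos _)
      (b := q) (a := q ^ (a - 1)) (by rw [← pow_succ, Nat.sub_add_cancel (by omega)])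
    set ζ := IsCyclotomicExtension.zeta (q ^ a) ℚ L ^ q ^ (a - 1)
    have hα0 : α ≠ 0 := by
      rintro rfl
      refine hn 0 ?_
      rw [zero_pow hq.ne_zero] at hα ⊢
      exact_mod_cast hα
    have hζF : ζ ∈ ℚ⟮α⟯ := by
      have := div_mem (mem_adjoin_of_minpoly_eq
        ((hmin α hα).trans (hmin (ζ * α) (by rw [mul_pow, hζ.pow_eq_one, one_mul, hα])).symm))
        (mem_adjoin_simple_self ℚ α)
      rwa [mul_div_cancel_right₀ _ hα0] at this
    have hdvd := natDegree_minpoly_dvd_of_mem_adjoin hζF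
    rw [← cyclotomic_eq_minpoly_rat hζ hq.pos, natDegree_cyclotomic, hmin α hα,
      Nat.totient_prime hq, natDegree_X_pow_sub_C] at hdvd
    rcases (Nat.dvd_prime hq).1 hdvd with h | h
    · omega
    · have := hq.pos
      omega

theorem dvd_sub_one_of_absNorm_eq {K : Type*} [Field K] [NumberField K] {m p : ℕ} [NeZero m]
    (hp : p.Prime) (hpm : ¬ p ∣ m) {ζ : 𝓞 K} (hζ : IsPrimitiveRoot ζ m)
    (P : HeightOneSpectrum (𝓞 K)) (hP : Ideal.absNorm P.asIdeal = p) : m ∣ p - 1 := by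
  have := P.isPrime
  have := P.isMaximal
  let _ := Ideal.Quotient.field P.asIdeal
  have : Finite (𝓞 K ⧸ P.asIdeal) := Ideal.finiteQuotientOfFreeOfNeBot _ P.ne_bot
  have := Fintype.ofFinite (𝓞 K ⧸ P.asIdeal)
  have hcard : Fintype.card (𝓞 K ⧸ P.asIdeal) = p := by
    rw [← Nat.card_eq_fintype_card, ← hP, Ideal.absNorm_apply, Submodule.cardQuot_apply]
  have hlies : P.asIdeal.LiesOver (Ideal.span {(p : ℤ)}) := by
    have := liesOver_resChar P
    rwa [resChar_eq_of_absNorm_eq hp hP] at this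
  have hmem : ζ ^ p - ζ ∈ P.asIdeal := by
    refine Ideal.Quotient.eq.1 ?_
    rw [map_pow, ← hcard, FiniteField.pow_card]
  have h1 : ζ ^ p = ζ := by
    refine eq_of_pow_eq_of_sub_mem (m := m) ?_ hmem ?_ ?_
    · rw [← pow_mul, mul_comm, pow_mul, hζ.pow_eq_one, one_pow]
    · have := intCast_mem_iff (p := p) P.asIdeal m
      rw [Int.cast_natCast] at this
      rw [this]
      exact_mod_cast hpm
    · rw [hζ.pow_eq_one]
      exact fun h ↦ P.isPrime.ne_top ((Ideal.eq_top_iff_one _).2 h)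
  refine hζ.dvd_of_pow_eq_one _ ?_
  have hζ0 : ζ ≠ 0 := hζ.ne_zero (NeZero.ne m)
  refine mul_right_cancel₀ hζ0 ?_
  rw [← pow_succ, Nat.sub_add_cancel hp.one_le, h1, one_mul]

/-- If `n` is a `q`-th power modulo `p` and `p ≡ 1` modulo `q`, then the roots of unity of order
`m ∣ p - 1` and the `q`-th roots of `n` are fixed by the `p`-power map modulo `p`. -/
theorem isKummerFixed_of_pow_eq {L : Type*} [Field L] [NumberField L] {m q p : ℕ} (hp : p.Prime)
    (hm : m ∣ p - 1) (hq : q ∣ p - 1) {n : ℤ} (hpn : ¬ (p : ℤ) ∣ n)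
    (hn : ∃ b : ZMod p, b ^ q = n)
    (htop : adjoin ℚ {x : L | x ^ m = 1 ∨ x ^ q = n} = ⊤) :
    IsKummerFixed p {x : 𝓞 L | x ^ m = 1 ∨ x ^ q = n} := by
  have hp1 : p - 1 ≠ 0 := by have := hp.two_le; omega
  have hdvd : ∀ k, k ∣ p - 1 → ¬ p ∣ k := fun k hk h ↦ by
    have := Nat.le_of_dvd (Nat.pos_of_ne_zero hp1) (h.trans hk)
    omega
  have hpos : ∀ k, k ∣ p - 1 → 0 < k := fun k hk ↦
    Nat.pos_of_ne_zero fun h ↦ hdvd k hk (h ▸ dvd_zero p)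
  refine ⟨?_, ?_, ?_⟩
  · rw [eq_top_iff, ← htop]
    refine adjoin.mono _ _ _ fun x hx ↦ ?_
    have hint : IsIntegral ℤ x := by
      rcases hx with h | h
      · exact IsIntegral.of_pow (hpos m hm) (h ▸ isIntegral_one)
      · exact IsIntegral.of_pow (hpos q hq) (h ▸ isIntegral_algebraMap (R := ℤ) (x := n))
    obtain ⟨y, rfl⟩ : ∃ y : 𝓞 L, (y : L) = x := ⟨⟨x, hint⟩, rfl⟩
    refine ⟨y, ?_, rfl⟩
    refine hx.imp (fun h ↦ RingOfIntegers.ext ?_) (fun h ↦ RingOfIntegers.ext ?_)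
    · exact_mod_cast h
    · simpa using h
  · rintro x (h | h)
    · refine ⟨m, 1, by simpa using h, hdvd m hm, ?_⟩
      exact_mod_cast hp.not_dvd_one
    · exact ⟨q, n, h, hdvd q hq, hpn⟩
  · rintro x (h | h)
    · obtain ⟨k, hk⟩ := hm
      rw [← Nat.sub_add_cancel hp.one_le, pow_succ, hk, pow_mul, h, one_pow, one_mul, sub_self]
      exact dvd_zero _
    · obtain ⟨k, hk⟩ := hq
      obtain ⟨b, hb⟩ := hn
      have : Fact p.Prime := ⟨hp⟩
      have hn1 : (p : ℤ) ∣ n ^ k - 1 := by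
        rw [← ZMod.intCast_zmod_eq_zero_iff_dvd]
        push_cast
        rw [← hb, ← pow_mul, ← hk, ZMod.pow_card_sub_one_eq_one, sub_self]
        rintro rfl
        rw [zero_pow (hpos q ⟨k, hk⟩).ne', eq_comm, ZMod.intCast_zmod_eq_zero_iff_dvd] at hb
        exact hpn hb
      have hx : x ^ p - x = ((n ^ k - 1 : ℤ) : 𝓞 L) * x := by
        nth_rw 1 [← Nat.sub_add_cancel hp.one_le, pow_succ, hk, pow_mul, h]
        push_cast
        ring
      rw [hx]
      refine Dvd.dvd.mul_right ?_ _
      simpa using map_dvd (Int.castRingHom (𝓞 L)) hn1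

theorem exists_prime_forall_pow_ne_of_isSplittingField {q a : ℕ} (hq : q.Prime)
    (ha : a ≠ 0) (h2 : q = 2 → a = 1) {n : ℤ} (hn0 : n ≠ 0) (hn : ∀ b : ℤ, b ^ q ≠ n)
    (L : Type*) [Field L] [NumberField L]
    [IsSplittingField ℚ L ((X ^ (q ^ a) - C 1) * (X ^ q - C (n : ℚ)))] (B : Finset ℕ) :
    ∃ p : ℕ, p.Prime ∧ p ∉ B ∧ q ^ a ∣ p - 1 ∧ ¬ (p : ℤ) ∣ n ∧ ∀ b : ZMod p, b ^ q ≠ n := by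
  by_contra! hcon
  have hqa : NeZero (q ^ a) := ⟨pow_ne_zero _ hq.ne_zero⟩
  let f : ℚ[X] := (X ^ (q ^ a) - C 1) * (X ^ q - C (n : ℚ))
  have hf0 : f ≠ 0 := mul_ne_zero (X_pow_sub_C_ne_zero (NeZero.pos _) _)
    (X_pow_sub_C_ne_zero hq.pos _)
  have : IsSplittingField ℚ L f := ‹_›
  have : Normal ℚ L := Normal.of_isSplittingField f
  have : IsGalois ℚ L := { }
  have hsplit : (f.map (algebraMap ℚ L)).Splits := IsSplittingField.splits L f
  have hfL : f.map (algebraMap ℚ L) ≠ 0 := Polynomial.map_ne_zero hf0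
  have htop : adjoin ℚ {x : L | x ^ (q ^ a) = 1 ∨ x ^ q = n} = ⊤ := by
    refine adjoin_eq_top_of_algebra _ _ (eq_top_iff.2 ?_)
    rw [← IsSplittingField.adjoin_rootSet L f]
    refine Algebra.adjoin_mono fun x hx ↦ ?_
    have := aeval_eq_zero_of_mem_rootSet hx
    simpa [f, sub_eq_zero] using this
  obtain ⟨ζ, hζ⟩ : ∃ ζ : L, IsPrimitiveRoot ζ (q ^ a) := by
    have h1 : ((cyclotomic (q ^ a) ℚ).map (algebraMap ℚ L)).Splits := by
      refine hsplit.of_dvd hfL (Polynomial.map_dvd _ ?_)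
      refine (cyclotomic.dvd_X_pow_sub_one _ _).trans ?_
      rw [← C_1]
      exact dvd_mul_right _ _
    obtain ⟨ζ, hζ⟩ := h1.exists_eval_eq_zero (by
      rw [map_cyclotomic, degree_cyclotomic]
      exact Nat.cast_ne_zero.2 (Nat.totient_pos.2 (NeZero.pos _)).ne')
    rw [map_cyclotomic] at hζ
    exact ⟨ζ, (isRoot_cyclotomic_iff).1 hζ⟩
  obtain ⟨α, hα⟩ : ∃ α : L, α ^ q = n := by
    have h1 : ((X ^ q - C (n : ℚ)).map (algebraMap ℚ L)).Splits :=
      hsplit.of_dvd hfL (Polynomial.map_dvd _ (dvd_mul_left _ _))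
    obtain ⟨α, hα⟩ := h1.exists_eval_eq_zero (by
      rw [degree_map, degree_X_pow_sub_C hq.pos]
      exact_mod_cast hq.ne_zero)
    exact ⟨α, by simpa [sub_eq_zero] using hα⟩
  let K := ℚ⟮ζ⟯
  have hK : IsCyclotomicExtension {q ^ a} ℚ K :=
    hζ.intermediateField_adjoin_isCyclotomicExtension (K := ℚ)
  have hαK : α ∉ K := fun h ↦
    pow_ne_of_isCyclotomicExtension hq ha h2 hn (⟨α, h⟩ : K) (Subtype.ext (by simpa using hα))
  have hrank : 2 * Module.finrank ℚ K ≤ Module.finrank ℚ L := by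
    rw [← Module.finrank_mul_finrank ℚ K L, mul_comm]
    refine Nat.mul_le_mul_left _ ?_
    have h0 : 0 < Module.finrank K L := Module.finrank_pos
    have h1 : Module.finrank K L ≠ 1 := fun h ↦ by
      have : K = ⊤ := IntermediateField.finrank_eq_one_iff_eq_top.1 h
      exact hαK (this ▸ trivial)
    omega
  refine primeZeta_compare_false (K := K) L (B := B ∪ {q} ∪ n.natAbs.primeFactors)
    fun p hp hpB ⟨P, hP⟩ ↦ ?_
  simp only [Finset.mem_union, Finset.mem_singleton, Nat.mem_primeFactors, not_or, not_and] at hpB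
  obtain ⟨⟨hpB, hpq⟩, hpn⟩ := hpB
  have hpn : ¬ (p : ℤ) ∣ n := fun h ↦
    hpn hp (Int.natCast_dvd.1 h) (Int.natAbs_ne_zero.2 hn0)
  have hpqa : ¬ p ∣ q ^ a := fun h ↦
    hpq ((Nat.prime_dvd_prime_iff_eq hp hq).1 (hp.dvd_of_dvd_pow h))
  have hdvd : q ^ a ∣ p - 1 := dvd_sub_one_of_absNorm_eq hp hpqa
    (IsCyclotomicExtension.zeta_spec (q ^ a) ℚ K).toInteger_isPrimitiveRoot P hP
  obtain ⟨T, hT, hcard⟩ := (isKummerFixed_of_pow_eq hp hdvd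
    ((dvd_pow_self q ha).trans hdvd) hpn (hcon p hp hpB hdvd hpn) htop).exists_finset hp
  exact ⟨T, hT, hcard ▸ hrank⟩

theorem exists_prime_forall_pow_ne {q a : ℕ} (hq : q.Prime) (ha : a ≠ 0) (h2 : q = 2 → a = 1)
    {n : ℤ} (hn0 : n ≠ 0) (hn : ∀ b : ℤ, b ^ q ≠ n) (B : Finset ℕ) :
    ∃ p : ℕ, p.Prime ∧ p ∉ B ∧ q ^ a ∣ p - 1 ∧ ¬ (p : ℤ) ∣ n ∧ ∀ b : ZMod p, b ^ q ≠ n := by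
  let f : ℚ[X] := (X ^ (q ^ a) - C 1) * (X ^ q - C (n : ℚ))
  have : NumberField f.SplittingField :=
    { to_charZero := inferInstance, to_finiteDimensional := inferInstance }
  have : @IsSplittingField ℚ f.SplittingField _ _ DivisionRing.toRatAlgebra f := by
    convert IsSplittingField.splittingField f
    exact Subsingleton.elim _ _
  exact exists_prime_forall_pow_ne_of_isSplittingField hq ha h2 hn0 hn f.SplittingField B

end PowerNonresidues

section Characters

/-- The tuples of values at the integers `g i` of the `A`-valued characters of `(ℤ/N)ˣ`, where `N`
ranges over the moduli prime to all `g i`. -/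
def charValues (A : Type*) [AddCommGroup A] {ι : Type*} (g : ι → ℤ) : AddSubgroup (ι → A) where
  carrier := {w | ∃ N : ℕ, N ≠ 0 ∧ ∃ χ : (ZMod N)ˣ →* Multiplicative A,
    ∀ i, ∃ u : (ZMod N)ˣ, (u : ZMod N) = g i ∧ (χ u).toAdd = w i}
  zero_mem' := ⟨1, one_ne_zero, 1, fun _ ↦ ⟨1, Subsingleton.elim _ _, rfl⟩⟩
  add_mem' := by
    rintro v w ⟨N, hN, χ, hχ⟩ ⟨M, hM, ψ, hψ⟩
    refine ⟨N * M, mul_ne_zero hN hM, χ.comp (ZMod.unitsMap (dvd_mul_right N M)) *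
      ψ.comp (ZMod.unitsMap (dvd_mul_left M N)), fun i ↦ ?_⟩
    obtain ⟨u, hu, hχu⟩ := hχ i
    obtain ⟨u', hu', hψu'⟩ := hψ i
    have h : IsUnit ((g i : ℤ) : ZMod (N * M)) := by
      rw [ZMod.coe_int_isUnit_iff_isCoprime, Nat.cast_mul]
      exact ((ZMod.coe_int_isUnit_iff_isCoprime _ _).1 (hu ▸ u.isUnit)).mul_left
        ((ZMod.coe_int_isUnit_iff_isCoprime _ _).1 (hu' ▸ u'.isUnit))
    refine ⟨h.unit, h.unit_spec, ?_⟩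
    have h1 : ZMod.unitsMap (dvd_mul_right N M) h.unit = u := Units.ext (by
      rw [ZMod.unitsMap_def, Units.coe_map, h.unit_spec, hu]
      exact map_intCast (ZMod.castHom (dvd_mul_right N M) (ZMod N)) _)
    have h2 : ZMod.unitsMap (dvd_mul_left M N) h.unit = u' := Units.ext (by
      rw [ZMod.unitsMap_def, Units.coe_map, h.unit_spec, hu']
      exact map_intCast (ZMod.castHom (dvd_mul_left M N) (ZMod M)) _)
    rw [MonoidHom.mul_apply, MonoidHom.comp_apply, MonoidHom.comp_apply, h1, h2, toAdd_mul, hχu,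
      hψu', Pi.add_apply]
  neg_mem' := by
    rintro v ⟨N, hN, χ, hχ⟩
    refine ⟨N, hN, χ⁻¹, fun i ↦ ?_⟩
    obtain ⟨u, hu, hχu⟩ := hχ i
    exact ⟨u, hu, by rw [MonoidHom.inv_apply, toAdd_inv, hχu, Pi.neg_apply]⟩

theorem mem_charValues {A : Type*} [AddCommGroup A] {ι : Type*} {g : ι → ℤ} {w : ι → A} :
    w ∈ charValues A g ↔ ∃ N : ℕ, N ≠ 0 ∧ ∃ χ : (ZMod N)ˣ →* Multiplicative A,
      ∀ i, ∃ u : (ZMod N)ˣ, (u : ZMod N) = g i ∧ (χ u).toAdd = w i :=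
  Iff.rfl

theorem map_mem_charValues {A A' : Type*} [AddCommGroup A] [AddCommGroup A'] {ι : Type*}
    {g : ι → ℤ} {w : ι → A} (f : A →+ A') (hw : w ∈ charValues A g) :
    (fun i ↦ f (w i)) ∈ charValues A' g := by
  obtain ⟨N, hN, χ, hχ⟩ := hw
  refine ⟨N, hN, f.toMultiplicative.comp χ, fun i ↦ ?_⟩
  obtain ⟨u, hu, hχu⟩ := hχ i
  refine ⟨u, hu, ?_⟩
  exact congrArg f hχu

theorem ZMod.exists_eq_nsmul_of_castHom_eq_zero {q m : ℕ} (hqm : q ∣ m) {x : ZMod m}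
    (hx : ZMod.castHom hqm (ZMod q) x = 0) : ∃ y : ZMod m, x = q • y := by
  obtain ⟨k, rfl⟩ := ZMod.intCast_surjective x
  rw [map_intCast, ZMod.intCast_zmod_eq_zero_iff_dvd] at hx
  obtain ⟨j, rfl⟩ := hx
  exact ⟨j, by simp⟩

/-- A character of `(ℤ/p)ˣ` whose reduction modulo `q` detects `q`-th powers. -/
theorem exists_char_of_dvd_sub_one {p m q : ℕ} (hp : p.Prime) (hm : m ∣ p - 1) (hqm : q ∣ m) :
    ∃ δ : (ZMod p)ˣ →* Multiplicative (ZMod m),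
      ∀ u, ZMod.castHom hqm (ZMod q) (δ u).toAdd = 0 → ∃ v, v ^ q = u := by
  have : Fact p.Prime := ⟨hp⟩
  have hcyc : IsCyclic (ZMod p)ˣ := inferInstance
  have hcard : Nat.card (ZMod p)ˣ = p - 1 := by
    rw [Nat.card_eq_fintype_card, ZMod.card_units]
  have hm' : m ∣ Nat.card (ZMod p)ˣ := hcard ▸ hm
  let e := zmodCyclicMulEquiv hcyc
  refine ⟨(ZMod.castHom hm' (ZMod m)).toAddMonoidHom.toMultiplicative.comp
    e.symm.toMonoidHom, fun u hu ↦ ?_⟩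
  have hu' : ZMod.castHom (hqm.trans hm') (ZMod q) (e.symm u).toAdd = 0 := by
    rw [← hu, ← ZMod.castHom_comp hqm hm']
    rfl
  obtain ⟨y, hy⟩ := ZMod.exists_eq_nsmul_of_castHom_eq_zero _ hu'
  refine ⟨e (Multiplicative.ofAdd y), ?_⟩
  rw [← map_pow, ← ofAdd_nsmul, ← hy]
  simp

theorem exists_mem_charValues_castHom_eq {q a : ℕ} (hq : q.Prime) (ha : a ≠ 0)
    (h2 : q = 2 → a = 1) {ι : Type*} [Fintype ι] {g : ι → ℤ} (hg : ∀ i, g i ≠ 0) (t : ι → ZMod q)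
    (ht : ∀ c : ι → ZMod q, (∃ b : ℤ, b ^ q = ∏ i, g i ^ (c i).val) → ∑ i, c i * t i = 0) :
    ∃ w ∈ charValues (ZMod (q ^ a)) g,
      ∀ i, ZMod.castHom (dvd_pow_self q ha) (ZMod q) (w i) = t i := by
  classical
  have : Fact q.Prime := ⟨hq⟩
  let π := (ZMod.castHom (dvd_pow_self q ha) (ZMod q)).toAddMonoidHom
  let W := AddSubgroup.toZModSubmodule q
    ((charValues (ZMod (q ^ a)) g).map (AddMonoidHom.compLeft π ι))
  suffices h : t ∈ W by
    obtain ⟨w, hw, hwt⟩ := (AddSubgroup.mem_toZModSubmodule q).1 h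
    exact ⟨w, hw, fun i ↦ congrFun hwt i⟩
  by_contra htW
  obtain ⟨f, hft, hfW⟩ := Submodule.exists_le_ker_of_notMem htW
  let c : ι → ZMod q := fun i ↦ f (Pi.single i 1)
  have hfc : ∀ v, f v = ∑ i, c i * v i := fun v ↦ by
    rw [LinearMap.pi_apply_eq_sum_univ f v]
    refine Finset.sum_congr rfl fun i _ ↦ ?_
    rw [smul_eq_mul, mul_comm]
    congr 2
    ext j
    simp [Pi.single_apply, eq_comm]
  have hpow : ∀ b : ℤ, b ^ q ≠ ∏ i, g i ^ (c i).val := fun b hb ↦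
    hft ((hfc t).trans (ht c ⟨b, hb⟩))
  have hn0 : ∏ i, g i ^ (c i).val ≠ 0 :=
    Finset.prod_ne_zero_iff.2 fun i _ ↦ pow_ne_zero _ (hg i)
  obtain ⟨p, hp, hpB, hqp, -, hpn⟩ := exists_prime_forall_pow_ne hq ha h2 hn0 hpow
    (Finset.univ.biUnion fun i ↦ (g i).natAbs.primeFactors)
  have : Fact p.Prime := ⟨hp⟩
  have hu : ∀ i, IsUnit (g i : ZMod p) := fun i ↦ by
    rw [isUnit_iff_ne_zero, Ne, ZMod.intCast_zmod_eq_zero_iff_dvd]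
    refine fun h ↦ hpB (Finset.mem_biUnion.2 ⟨i, Finset.mem_univ i, ?_⟩)
    exact Nat.mem_primeFactors.2 ⟨hp, Int.natCast_dvd.1 h, Int.natAbs_ne_zero.2 (hg i)⟩
  obtain ⟨δ, hδ⟩ := exists_char_of_dvd_sub_one hp hqp (dvd_pow_self q ha)
  let w : ι → ZMod (q ^ a) := fun i ↦ (δ (hu i).unit).toAdd
  have hw : w ∈ charValues (ZMod (q ^ a)) g :=
    ⟨p, hp.ne_zero, δ, fun i ↦ ⟨(hu i).unit, (hu i).unit_spec, rfl⟩⟩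
  have hfw : f (fun i ↦ π (w i)) = 0 := hfW ⟨w, hw, rfl⟩
  obtain ⟨v, hv⟩ := hδ (∏ i, (hu i).unit ^ (c i).val) (by
    rw [map_prod, toAdd_prod, map_sum, ← hfw, hfc]
    refine Finset.sum_congr rfl fun i _ ↦ ?_
    rw [map_pow, toAdd_pow, map_nsmul, nsmul_eq_mul, ZMod.natCast_val, ZMod.cast_id', id]
    rfl)
  refine hpn v ?_
  rw [← Units.val_pow_eq_pow_val, hv]
  simp

theorem eq_zero_of_pow_eq_prod_pow {q : ℕ} {S : Finset ℕ} (hS : ∀ l ∈ S, l.Prime)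
    {e : S → ℕ} (he : ∀ l, e l < q) {b : ℕ} (hb : b ^ q = ∏ l : S, (l : ℕ) ^ e l) (l : S) :
    e l = 0 := by
  have h := congrArg (fun n ↦ n.factorization l) hb
  simp only [Nat.factorization_pow, Finsupp.smul_apply, smul_eq_mul] at h
  rw [Nat.factorization_prod fun (x : S) _ ↦ pow_ne_zero _ (hS x x.2).ne_zero,
    Finsupp.finsetSum_apply,
    Finset.sum_eq_single l] at h
  · rw [(hS l l.2).factorization_pow, Finsupp.single_eq_same] at h
    exact Nat.eq_zero_of_dvd_of_lt ⟨_, h.symm⟩ (he l)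
  · intro x _ hx
    rw [(hS x x.2).factorization_pow, Finsupp.single_eq_of_ne]
    exact fun h ↦ hx (Subtype.ext h.symm)
  · simp

/-- The integers `-1` and `l`, for `l ∈ S`. -/
def negOneAndPrimes (S : Finset ℕ) (i : Option S) : ℤ :=
  i.elim (-1) fun l ↦ (l : ℕ)

theorem exists_mem_charValues_primePow {q a : ℕ} (hq : q.Prime) (ha : a ≠ 0) (h2 : q = 2 → a = 1)
    {S : Finset ℕ} (hS : ∀ l ∈ S, l.Prime) :
    ∃ w ∈ charValues (ZMod (q ^ a)) (negOneAndPrimes S),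
      (∀ l, ZMod.castHom (dvd_pow_self q ha) (ZMod q) (w (some l)) = 1) ∧
      (q = 2 → ZMod.castHom (dvd_pow_self q ha) (ZMod q) (w none) = 1) := by
  have : Fact q.Prime := ⟨hq⟩
  let t : Option S → ZMod q := fun i ↦ i.elim (if q = 2 then 1 else 0) fun _ ↦ 1
  obtain ⟨w, hw, hwt⟩ := exists_mem_charValues_castHom_eq hq ha h2 (g := negOneAndPrimes S)
    (fun i ↦ by
      cases i with
      | none => exact neg_ne_zero.2 one_ne_zero
      | some l => exact Int.natCast_ne_zero.2 (hS l l.2).ne_zero) t (by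
    rintro c ⟨b, hb⟩
    rw [Fintype.prod_option] at hb
    simp only [negOneAndPrimes, Option.elim_none, Option.elim_some] at hb
    have hb' := congrArg Int.natAbs hb
    simp only [Int.natAbs_pow, Int.natAbs_mul, Int.natAbs_neg, Int.natAbs_one, one_pow,
      one_mul, ← Nat.cast_pow, ← Nat.cast_prod, Int.natAbs_natCast] at hb'
    have hc : ∀ l, c (some l) = 0 := fun l ↦ (ZMod.val_eq_zero _).1
      (eq_zero_of_pow_eq_prod_pow hS (fun l ↦ ZMod.val_lt (c (some l))) hb' l)
    simp only [hc, ZMod.val_zero, pow_zero, Finset.prod_const_one, mul_one] at hb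
    simp only [Fintype.sum_option, hc, zero_mul, Finset.sum_const_zero, add_zero]
    by_cases hq2 : q = 2
    · subst hq2
      have h0 : (c none).val = 0 := by
        have := ZMod.val_lt (c none)
        by_contra h
        rw [show (c none).val = 1 by omega, pow_one] at hb
        linarith [sq_nonneg b]
      rw [(ZMod.val_eq_zero _).1 h0, zero_mul]
    · simp [t, hq2])
  refine ⟨w, hw, fun l ↦ hwt _, fun hq2 ↦ (hwt _).trans ?_⟩
  simp [t, hq2]

theorem exists_mem_charValues_isUnit {m : ℕ} (hm0 : m ≠ 0) (hm : m.factorization 2 ≤ 1)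
    {S : Finset ℕ} (hS : ∀ l ∈ S, l.Prime) :
    ∃ w ∈ charValues (ZMod m) (negOneAndPrimes S),
      (∀ l, IsUnit (w (some l))) ∧ (2 ∣ m → w none ≠ 0) := by
  classical
  have : NeZero m := ⟨hm0⟩
  have key : ∀ q : m.primeFactors, ∃ w ∈ charValues (ZMod m) (negOneAndPrimes S),
      (∀ q' : ℕ, ∀ hq' : q'.Prime, ∀ hqm : q' ∣ m, q' ≠ q →
        ∀ i, ZMod.castHom hqm (ZMod q') (w i) = 0) ∧
      (∀ hqm : (q : ℕ) ∣ m, (∀ l, ZMod.castHom hqm (ZMod q) (w (some l)) ≠ 0) ∧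
        ((q : ℕ) = 2 → ZMod.castHom hqm (ZMod q) (w none) ≠ 0)) := by
    rintro ⟨q, hq⟩
    have hqp := Nat.prime_of_mem_primeFactors hq
    have hqm := Nat.dvd_of_mem_primeFactors hq
    set a := m.factorization q with ha
    have ha0 : a ≠ 0 := (hqp.factorization_pos_of_dvd hm0 hqm).ne'
    obtain ⟨w, hw, hw1, hw2⟩ := exists_mem_charValues_primePow hqp ha0
      (fun h ↦ by subst h; omega) hS
    obtain ⟨k, hk⟩ : q ^ a ∣ m := Nat.ordProj_dvd m q
    have hqk : ¬ q ∣ k := by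
      have := Nat.not_dvd_ordCompl hqp hm0
      rwa [← ha, hk, Nat.mul_div_cancel_left _ (pow_pos hqp.pos a)] at this
    have hf : (AddMonoidHom.mulLeft (k : ZMod m)).comp (Int.castAddHom (ZMod m)) ((q ^ a : ℕ) : ℤ)
        = 0 := by
      have : ((q ^ a * k : ℕ) : ZMod m) = 0 := hk ▸ ZMod.natCast_self m
      push_cast at this
      rw [mul_comm] at this
      simpa using this
    let f : ZMod (q ^ a) →+ ZMod m := ZMod.lift (q ^ a) ⟨_, hf⟩
    have hfc : ∀ z : ℤ, f z = k * z := fun z ↦ ZMod.lift_coe _ _ z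
    refine ⟨fun i ↦ f (w i), map_mem_charValues f hw, fun q' hq' hqm' hne i ↦ ?_, fun hqm ↦ ?_⟩
    · obtain ⟨z, hz⟩ := ZMod.intCast_surjective (w i)
      have hd : q' ∣ k := by
        rw [hk] at hqm'
        refine (hq'.dvd_mul.1 hqm').resolve_left fun h ↦ hne ?_
        exact (Nat.prime_dvd_prime_iff_eq hq' hqp).1 (hq'.dvd_of_dvd_pow h)
      change ZMod.castHom hqm' (ZMod q') (f (w i)) = 0
      rw [← hz, hfc, map_mul, map_natCast, (ZMod.natCast_eq_zero_iff _ _).2 hd, zero_mul]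
    · have : Fact q.Prime := ⟨hqp⟩
      have h : ∀ i, ZMod.castHom (dvd_pow_self q ha0) (ZMod q) (w i) = 1 →
          ZMod.castHom hqm (ZMod q) (f (w i)) ≠ 0 := fun i hi ↦ by
        obtain ⟨z, hz⟩ := ZMod.intCast_surjective (w i)
        rw [← hz, map_intCast] at hi
        rw [← hz, hfc, map_mul, map_natCast, map_intCast, hi, mul_one, Ne,
          ZMod.natCast_eq_zero_iff]
        exact hqk
      exact ⟨fun l ↦ h _ (hw1 l), fun h2 ↦ h _ (hw2 h2)⟩
  choose w hw hw0 hw1 using key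
  have hsum : ∀ i, ∀ q : ℕ, ∀ hq : q ∈ m.primeFactors, ∀ hqm : q ∣ m,
      ZMod.castHom hqm (ZMod q) (∑ q', w q' i) = ZMod.castHom hqm (ZMod q) (w ⟨q, hq⟩ i) := by
    intro i q hq hqm
    rw [map_sum, Finset.sum_eq_single ⟨q, hq⟩]
    · intro q' _ hne
      exact hw0 q' q (Nat.prime_of_mem_primeFactors hq) hqm (fun h ↦ hne (Subtype.ext h.symm)) i
    · simp
  refine ⟨∑ q, w q, AddSubgroup.sum_mem _ fun q _ ↦ hw q, fun l ↦ ?_, fun h2 h ↦ ?_⟩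
  · rw [Finset.sum_apply]
    obtain ⟨z, hz⟩ := ZMod.intCast_surjective (∑ q, w q (some l))
    rw [← hz, ZMod.coe_int_isUnit_iff_isCoprime, Int.isCoprime_iff_gcd_eq_one]
    by_contra hne
    obtain ⟨q, hq, hqd⟩ := Nat.exists_prime_and_dvd hne
    have hqm : q ∣ m := by exact_mod_cast hqd.trans (Int.gcd_dvd_natAbs_left _ _)
    have hmem : q ∈ m.primeFactors := Nat.mem_primeFactors.2 ⟨hq, hqm, hm0⟩
    refine (hw1 ⟨q, hmem⟩ hqm).1 l ?_
    rw [← hsum _ q hmem hqm, ← hz, map_intCast, ZMod.intCast_zmod_eq_zero_iff_dvd]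
    exact Int.natCast_dvd.2 (hqd.trans (Int.gcd_dvd_natAbs_right _ _))
  · have hmem : 2 ∈ m.primeFactors := Nat.mem_primeFactors.2 ⟨Nat.prime_two, h2, hm0⟩
    refine (hw1 ⟨2, hmem⟩ h2).2 rfl ?_
    rw [← hsum _ 2 hmem h2, ← Finset.sum_apply, h, map_zero]

/-- There is a character of order `m` which is nontrivial at `-1` and takes generators as values at
the primes of `S`. -/
theorem exists_char_zmultiples_eq_top {m : ℕ} (hm0 : m ≠ 0) (h2m : 2 ∣ m)
    (hm : m.factorization 2 ≤ 1) {S : Finset ℕ} (hS : ∀ l ∈ S, l.Prime) :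
    ∃ N : ℕ, N ≠ 0 ∧ ∃ χ : (ZMod N)ˣ →* Multiplicative (ZMod m), χ (-1) ≠ 1 ∧
      ∀ l ∈ S, ∃ u : (ZMod N)ˣ, (u : ZMod N) = l ∧ Subgroup.zpowers (χ u) = ⊤ := by
  obtain ⟨w, ⟨N, hN, χ, hχ⟩, hw1, hw2⟩ := exists_mem_charValues_isUnit hm0 hm hS
  refine ⟨N, hN, χ, fun h ↦ ?_, fun l hl ↦ ?_⟩
  · obtain ⟨u, hu, hχu⟩ := hχ none
    have : u = -1 := Units.ext (by simpa [negOneAndPrimes] using hu)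
    rw [this, h] at hχu
    exact hw2 h2m hχu.symm
  · obtain ⟨u, hu, hχu⟩ := hχ (some ⟨l, hl⟩)
    refine ⟨u, by simpa [negOneAndPrimes] using hu, eq_top_iff.2 fun x _ ↦ ?_⟩
    obtain ⟨v, hv⟩ := hw1 ⟨l, hl⟩
    obtain ⟨z, hz⟩ := ZMod.intCast_surjective (x.toAdd * (↑v⁻¹ : ZMod m))
    refine ⟨z, Multiplicative.toAdd.injective ?_⟩
    change z • (χ u).toAdd = x.toAdd
    rw [hχu, ← hv, zsmul_eq_mul, hz, Units.inv_mul_cancel_right]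

end Characters

section FixedField

open IsCyclotomicExtension.Rat Pointwise

theorem exists_isConj_of_isCyclotomicExtension {N : ℕ} [NeZero N] {K : Type*} [Field K]
    [NumberField K] [IsCyclotomicExtension {N} ℚ K] (ψ : K →+* ℂ)
    (x : K) : ψ ((galEquivZMod N K).symm (-1) x) = star (ψ x) := by
  have hζ := IsCyclotomicExtension.zeta_spec N ℚ K
  set σ : Gal(K/ℚ) := (galEquivZMod N K).symm (-1)
  have hσ : galEquivZMod N K σ = -1 := MulEquiv.apply_symm_apply _ _
  have h : (ψ.comp (σ : K ≃+* K).toRingHom).toRatAlgHom = ((starRingEnd ℂ).comp ψ).toRatAlgHom := by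
    refine (hζ.powerBasis ℚ).algHom_ext ?_
    rw [hζ.powerBasis_gen ℚ]
    change ψ (σ _) = star (ψ _)
    set ζ := IsCyclotomicExtension.zeta N ℚ K
    have h1 : ζ * σ ζ = 1 := by
      rw [galEquivZMod_apply_of_pow_eq N K σ hζ.pow_eq_one, ← pow_succ', hζ.pow_eq_one_iff_dvd,
        ← ZMod.natCast_eq_zero_iff, hσ, Nat.cast_add, Nat.cast_one, ZMod.natCast_zmod_val,
        Units.val_neg, Units.val_one, neg_add_cancel]
    have h2 : ‖ψ ζ‖ = 1 := Complex.norm_eq_one_of_pow_eq_one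
      (by rw [← map_pow, hζ.pow_eq_one, map_one]) (NeZero.ne N)
    rw [eq_inv_of_mul_eq_one_right h1, map_inv₀, Complex.inv_eq_conj h2]
    rfl
  exact DFunLike.congr_fun h x

variable {N : ℕ} [NeZero N] {K : Type*} [Field K] [NumberField K] [IsCyclotomicExtension {N} ℚ K]
  {E : Type*} [Field E] [NumberField E] [Algebra E K] {G : Type*} [CommGroup G]
  {χ : (ZMod N)ˣ →* G}

/-- `E` is the subfield of `ℚ(ζ_N)` cut out by the kernel of `χ`. -/
structure IsFixedByKer (E K : Type*) [Field E] [NumberField E] [Field K] [NumberField K]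
    [Algebra E K] [IsCyclotomicExtension {N} ℚ K] (χ : (ZMod N)ˣ →* G) : Prop where
  forall_eq_iff (σ : Gal(K/ℚ)) :
    (∀ x : E, σ (algebraMap E K x) = algebraMap E K x) ↔ χ (galEquivZMod N K σ) = 1

theorem IsFixedByKer.isTotallyComplex (h : IsFixedByKer E K χ) (hχ : χ (-1) ≠ 1) :
    IsTotallyComplex E := by
  refine ⟨fun v ↦ InfinitePlace.not_isReal_iff_isComplex.1 fun hv ↦ hχ ?_⟩
  rw [InfinitePlace.isReal_iff, ComplexEmbedding.isReal_iff] at hv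
  have := (h.forall_eq_iff ((galEquivZMod N K).symm (-1))).1 fun x ↦ by
    refine (ComplexEmbedding.lift K v.embedding).injective ?_
    rw [exists_isConj_of_isCyclotomicExtension, ComplexEmbedding.lift_algebraMap_apply]
    exact DFunLike.congr_fun hv x
  rwa [MulEquiv.apply_symm_apply] at this

theorem exists_mulEquiv_of_ker_eq {A B C : Type*} [Group A] [Group B] [Group C] {f : A →* B}
    {g : A →* C} (hf : Function.Surjective f) (hg : Function.Surjective g) (h : f.ker = g.ker) :
    ∃ e : B ≃* C, ∀ a, e (f a) = g a := by
  refine ⟨(QuotientGroup.quotientKerEquivOfSurjective f hf).symm.trans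
    ((QuotientGroup.quotientMulEquivOfEq h).trans
      (QuotientGroup.quotientKerEquivOfSurjective g hg)), fun a ↦ ?_⟩
  have : (QuotientGroup.quotientKerEquivOfSurjective f hf).symm (f a) = (a : A ⧸ f.ker) := by
    rw [MulEquiv.symm_apply_eq]
    rfl
  simp only [MulEquiv.trans_apply, this]
  rfl

theorem IsFixedByKer.exists_mulEquiv [IsGalois ℚ E] (h : IsFixedByKer E K χ)
    (hχ : Function.Surjective χ) :
    ∃ e : Gal(E/ℚ) ≃* G, ∀ σ : Gal(K/ℚ), e (σ.restrictNormal E) = χ (galEquivZMod N K σ) := by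
  have : IsGalois ℚ K := IsCyclotomicExtension.isGalois {N} ℚ K
  refine exists_mulEquiv_of_ker_eq (f := AlgEquiv.restrictNormalHom E)
    (g := χ.comp (galEquivZMod N K).toMonoidHom) (AlgEquiv.restrictNormalHom_surjective K)
    (hχ.comp (galEquivZMod N K).surjective) ?_
  ext σ
  rw [MonoidHom.mem_ker, MonoidHom.mem_ker]
  refine Iff.trans ?_ (h.forall_eq_iff σ)
  refine ⟨fun h1 x ↦ ?_, fun h1 ↦ AlgEquiv.ext fun x ↦ (algebraMap E K).injective ?_⟩
  · rw [← AlgEquiv.restrictNormal_commutes]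
    exact congrArg (algebraMap E K) (DFunLike.congr_fun h1 x)
  · exact (AlgEquiv.restrictNormal_commutes σ E x).trans (h1 x)

theorem smul_under_eq [IsGalois ℚ E] {σ : Gal(K/ℚ)} {P : Ideal (𝓞 K)} (hσ : σ • P = P) :
    σ.restrictNormal E • P.under (𝓞 E) = P.under (𝓞 E) := by
  have hcomm : ∀ x : 𝓞 E, algebraMap (𝓞 E) (𝓞 K) (σ.restrictNormal E • x) =
      σ • algebraMap (𝓞 E) (𝓞 K) x := fun x ↦
    RingOfIntegers.ext (AlgEquiv.restrictNormal_commutes σ E x)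
  ext y
  obtain ⟨x, rfl⟩ := MulAction.surjective (σ.restrictNormal E) y
  rw [Ideal.smul_mem_pointwise_smul_iff, Ideal.mem_comap, Ideal.mem_comap, hcomm]
  nth_rw 2 [← hσ]
  rw [Ideal.smul_mem_pointwise_smul_iff]

theorem isPrime_span_of_smul_eq {E : Type*} [Field E] [NumberField E] [IsGalois ℚ E] {l : ℕ}
    (hl : l.Prime) (Q : Ideal (𝓞 E)) [hQ : Q.IsPrime] [hQl : Q.LiesOver (Ideal.span {(l : ℤ)})]
    (hσ : ∀ σ : Gal(E/ℚ), σ • Q = Q) (he : Ideal.ramificationIdx Q ℤ = 1) :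
    (Ideal.span {(l : 𝓞 E)}).IsPrime := by
  have hl0 : Ideal.span {(l : ℤ)} ≠ ⊥ := by simpa using hl.ne_zero
  have hlp : (Ideal.span {(l : ℤ)}).IsPrime :=
    (Ideal.span_singleton_prime (by exact_mod_cast hl.ne_zero)).2 (Nat.prime_iff_prime_int.1 hl)
  have huniq : ∀ Q' : Ideal (𝓞 E), Q'.IsPrime → Q'.LiesOver (Ideal.span {(l : ℤ)}) → Q' = Q := by
    intro Q' h1 h2
    obtain ⟨σ, h⟩ := Ideal.exists_smul_eq_of_isGaloisGroup (Ideal.span {(l : ℤ)}) Q Q' Gal(E/ℚ)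
    rw [← h, hσ]
  have hlm : (Ideal.span {(l : ℤ)}).IsMaximal := hlp.isMaximal hl0
  have hmap : Ideal.span {(l : 𝓞 E)} = Q := by
    have h := Ideal.map_algebraMap_eq_finsetProd_pow (R := 𝓞 E) hl0
    rw [Ideal.map_span, Set.image_singleton, map_natCast] at h
    rw [h, Finset.prod_eq_single Q, he, pow_one]
    · intro Q' hQ' hne
      have hQ'' := Set.mem_toFinset.1 hQ'
      exact absurd (huniq Q' hQ''.1 hQ''.2) hne
    · exact fun hQ' ↦ absurd (Set.mem_toFinset.2 (show Q ∈ Ideal.primesOver _ _ from ⟨hQ, hQl⟩)) hQ'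
  exact hmap ▸ hQ

theorem IsFixedByKer.isPrime_span [IsGalois ℚ E] (h : IsFixedByKer E K χ)
    (hχ : Function.Surjective χ) {l : ℕ} (hl : l.Prime) {u : (ZMod N)ˣ} (hu : (u : ZMod N) = l)
    (hχu : Subgroup.zpowers (χ u) = ⊤) : (Ideal.span {(l : 𝓞 E)}).IsPrime := by
  obtain ⟨e, he⟩ := h.exists_mulEquiv hχ
  have : Fact l.Prime := ⟨hl⟩
  have hlN : l.Coprime N := (ZMod.isUnit_iff_coprime l N).1 (hu ▸ u.isUnit)
  have hlN' : ¬ l ∣ N := (Nat.Prime.coprime_iff_not_dvd hl).1 hlN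
  have hl0 : Ideal.span {(l : ℤ)} ≠ ⊥ := by simpa using hl.ne_zero
  have hlp : (Ideal.span {(l : ℤ)}).IsPrime :=
    (Ideal.span_singleton_prime (by exact_mod_cast hl.ne_zero)).2 (Nat.prime_iff_prime_int.1 hl)
  have hlm : (Ideal.span {(l : ℤ)}).IsMaximal := hlp.isMaximal hl0
  obtain ⟨P, hP, hPl⟩ := Ideal.nonempty_primesOver (S := 𝓞 K) (P := Ideal.span {(l : ℤ)})
  have hPm : P.IsMaximal := .of_liesOver_isMaximal P (Ideal.span {(l : ℤ)})
  have hu' : ZMod.unitOfCoprime l hlN = u := Units.ext (by rw [ZMod.coe_unitOfCoprime, hu])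
  obtain ⟨σ, hσ, hσu⟩ : ∃ σ : Gal(K/ℚ), σ • P = P ∧ galEquivZMod N K σ = u := by
    have := (galEquivZMod_stabilizer N K l P hlN).ge (hu' ▸ Subgroup.mem_zpowers u)
    obtain ⟨σ, hσ, h⟩ := this
    exact ⟨σ, hσ, h.trans hu'⟩
  have hgen : ∀ τ : Gal(E/ℚ), τ ∈ Subgroup.zpowers (σ.restrictNormal E) := fun τ ↦ by
    obtain ⟨k, hk⟩ := (hχu.ge trivial : e τ ∈ Subgroup.zpowers (χ u))
    refine ⟨k, e.injective ?_⟩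
    rw [← hk, ← hσu, ← he, map_zpow]
  have hQl : (P.under (𝓞 E)).LiesOver (Ideal.span {(l : ℤ)}) := inferInstance
  refine isPrime_span_of_smul_eq hl (P.under (𝓞 E)) (fun τ ↦ ?_) ?_
  · have : Subgroup.zpowers (σ.restrictNormal E) ≤ MulAction.stabilizer _ (P.under (𝓞 E)) :=
      (Subgroup.zpowers_le).2 (smul_under_eq hσ)
    exact this (hgen τ)
  · have h1 := ramificationIdx_eq_of_not_dvd (m := N) l K P hlN'
    rw [Ideal.ramificationIdx_tower (q := P.under (𝓞 E))] at h1
    exact Nat.eq_one_of_mul_eq_one_right h1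

end FixedField

section InertPrimes

theorem exists_prime_not_isPrime_span {E : Type*} [Field E] [NumberField E] [IsGalois ℚ E]
    (hE : 1 < Module.finrank ℚ E) :
    ∃ p : ℕ, p.Prime ∧ ¬ (Ideal.span {(p : 𝓞 E)}).IsPrime := by
  obtain ⟨p, hp, h⟩ := exists_not_isUnramifiedAt_int_of_isGalois (𝒪 := 𝓞 E) hE
  refine ⟨p, hp, fun hP ↦ h _ hP (Ideal.mem_span_singleton_self _) ?_⟩
  have hp0 : (p : 𝓞 E) ≠ 0 := by exact_mod_cast hp.ne_zero
  have hmap : (Ideal.span {(p : ℤ)}).map (algebraMap ℤ (𝓞 E)) = Ideal.span {(p : 𝓞 E)} := by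
    rw [Ideal.map_span, Set.image_singleton, map_natCast]
  have hb : Ideal.span {(p : 𝓞 E)} ≠ ⊥ := by simpa using hp0
  have hm : (Ideal.span {(p : ℤ)}).IsMaximal :=
    ((Ideal.span_singleton_prime (by exact_mod_cast hp.ne_zero)).2
      (Nat.prime_iff_prime_int.1 hp)).isMaximal (by simpa using hp.ne_zero)
  have : (Ideal.span {(p : 𝓞 E)}).LiesOver (Ideal.span {(p : ℤ)}) :=
    ⟨hm.eq_of_le (Ideal.IsPrime.under ℤ _).ne_top (Ideal.map_le_iff_le_comap.1 hmap.le)⟩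
  rw [← Ideal.ramificationIdx_eq_one_iff,
    Ideal.IsDedekindDomain.ramificationIdx_eq_normalizedFactors_count (Ideal.span {(p : ℤ)}) _
      (hmap ▸ hb), hmap,
    UniqueFactorizationMonoid.normalizedFactors_irreducible
      (Ideal.prime_of_isPrime hb hP).irreducible, normalize_eq, Multiset.count_singleton_self]

theorem exists_prime_not_isPrime_span_intermediateField {L : Type*} [Field L] [CharZero L]
    (E : IntermediateField ℚ L) (hG : IsGalois ℚ E) (hE : 1 < Module.finrank ℚ E) :
    ∃ p : ℕ, p.Prime ∧ ¬ (Ideal.span {(p : 𝓞 E)}).IsPrime := by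
  have : FiniteDimensional ℚ E := Module.finite_of_finrank_pos (by omega)
  have : NumberField E := { to_finiteDimensional := by convert this }
  have : IsGalois ℚ E := hG
  exact exists_prime_not_isPrime_span hE

theorem exists_im_ne_zero_of_isTotallyComplex {E : Type*} [Field E] [NumberField E]
    [IsTotallyComplex E] (ψ : E →+* ℂ) : ∃ x, (ψ x).im ≠ 0 := by
  by_contra! h
  exact IsTotallyComplex.complexEmbedding_not_isReal ψ <| ComplexEmbedding.isReal_iff.2 <|
    RingHom.ext fun x ↦ Complex.conj_eq_iff_im.2 (h x)

theorem im_eq_zero_of_isTotallyReal {F : Type*} [Field F] [NumberField F] [IsTotallyReal F]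
    (ψ : F →+* ℂ) (x : F) : (ψ x).im = 0 :=
  Complex.conj_eq_iff_im.1 <| DFunLike.congr_fun
    (ComplexEmbedding.isReal_iff.1 (IsTotallyReal.complexEmbedding_isReal ψ)) x

theorem exists_subfield_of_isCMField (E : Type*) [Field E] [NumberField E] [IsCMField E] :
    ∃ F : Subfield E, (∀ ψ : F →+* ℂ, ∀ x, (ψ x).im = 0) ∧ Module.finrank F E = 2 :=
  ⟨maximalRealSubfield E, im_eq_zero_of_isTotallyReal,
    Algebra.IsQuadraticExtension.finrank_eq_two _ _⟩

theorem IsFixedByKer.isGalois_and_isCyclic {N m : ℕ} [NeZero N] [NeZero m] {K : Type*} [Field K]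
    [NumberField K] [IsCyclotomicExtension {N} ℚ K] {E : Type*} [Field E] [NumberField E]
    [Algebra E K] [inst : Algebra ℚ E] {χ : (ZMod N)ˣ →* Multiplicative (ZMod m)}
    (h : IsFixedByKer E K χ) (hχ : Function.Surjective χ) :
    IsAbelianGalois ℚ E ∧ IsCyclic (E ≃ₐ[ℚ] E) ∧ Nat.card (E ≃ₐ[ℚ] E) = m ∧
      Module.finrank ℚ E = m := by
  obtain rfl : inst = DivisionRing.toRatAlgebra := Subsingleton.elim _ _
  have : IsAbelianGalois ℚ K := IsCyclotomicExtension.isAbelianGalois {N} ℚ K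
  have : IsAbelianGalois ℚ E := IsAbelianGalois.tower_bot ℚ E K
  obtain ⟨e, -⟩ := h.exists_mulEquiv hχ
  have hcard : Nat.card Gal(E/ℚ) = m := by
    rw [Nat.card_congr e.toEquiv, Nat.card_congr Multiplicative.toAdd, Nat.card_zmod]
  exact ⟨this, isCyclic_of_surjective e.symm e.symm.surjective, hcard,
    (IsGalois.card_aut_eq_finrank ℚ E).symm.trans hcard⟩

theorem exists_isFixedByKer {N : ℕ} [NeZero N] (K : Type*) [Field K] [NumberField K]
    [IsCyclotomicExtension {N} ℚ K] {G : Type*} [CommGroup G] (χ : (ZMod N)ˣ →* G) :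
    ∃ E : IntermediateField ℚ (AlgebraicClosure ℚ), ∃ _ : NumberField E, ∃ _ : Algebra E K,
      IsFixedByKer E K χ := by
  let χ' : Gal(K/ℚ) →* G := χ.comp (IsCyclotomicExtension.Rat.galEquivZMod N K).toMonoidHom
  let E₀ : IntermediateField ℚ K := IntermediateField.fixedField χ'.ker
  let f : K →ₐ[ℚ] AlgebraicClosure ℚ := IsAlgClosed.lift
  let e : E₀ ≃ₐ[ℚ] E₀.map f := E₀.equivMap f
  have : FiniteDimensional ℚ (E₀.map f) := Module.Finite.equiv e.toLinearEquiv
  have hN : NumberField (E₀.map f) := { to_finiteDimensional := by convert this }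
  let alg : Algebra (E₀.map f) K :=
    ((algebraMap E₀ K).comp (e.symm : E₀.map f →+* E₀)).toAlgebra
  refine ⟨E₀.map f, hN, alg, ⟨fun σ ↦ ?_⟩⟩
  have h := IntermediateField.fixingSubgroup_fixedField χ'.ker
  change _ ↔ σ ∈ χ'.ker
  rw [← h, IntermediateField.mem_fixingSubgroup_iff]
  exact ⟨fun h x hx ↦ by simpa [RingHom.algebraMap_toAlgebra] using h (e ⟨x, hx⟩),
    fun h x ↦ h _ (e.symm x).2⟩

theorem exists_intermediateField {d : ℕ} (hd : Odd d) {S : Finset ℕ} (hS : ∀ l ∈ S, l.Prime) :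
    ∃ E : IntermediateField ℚ (AlgebraicClosure ℚ),
      (IsGalois ℚ E ∧ IsCyclic (E ≃ₐ[ℚ] E) ∧ Nat.card (E ≃ₐ[ℚ] E) = 2 * d ∧
        Module.finrank ℚ E = 2 * d) ∧
      ((∀ ψ : E →+* ℂ, ∃ x, (ψ x).im ≠ 0) ∧
        ∃ F : Subfield E, (∀ ψ : F →+* ℂ, ∀ x, (ψ x).im = 0) ∧ Module.finrank F E = 2) ∧
      ∀ l ∈ S, (Ideal.span {(l : 𝓞 E)}).IsPrime := by
  have hd0 : d ≠ 0 := hd.pos.ne'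
  have hm : (2 * d).factorization 2 ≤ 1 := by
    rw [Nat.factorization_mul two_ne_zero hd0, Finsupp.add_apply,
      Nat.factorization_eq_zero_of_not_dvd hd.not_two_dvd_nat, Nat.prime_two.factorization_self]
  obtain ⟨N, hN, χ, hχ1, hχ⟩ := exists_char_zmultiples_eq_top (S := insert 2 S)
    (mul_ne_zero two_ne_zero hd0) (dvd_mul_right 2 d) hm (by simpa [Nat.prime_two] using hS)
  have : NeZero N := ⟨hN⟩
  have : NeZero (2 * d) := ⟨mul_ne_zero two_ne_zero hd0⟩
  have hsurj : Function.Surjective χ := fun x ↦ by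
    obtain ⟨u, -, hu⟩ := hχ 2 (Finset.mem_insert_self 2 S)
    obtain ⟨k, hk⟩ := (hu.ge trivial : x ∈ Subgroup.zpowers (χ u))
    exact ⟨u ^ k, by rw [map_zpow]; exact hk⟩
  have : IsCyclotomicExtension {N} ℚ (CyclotomicField N ℚ) := by
    have h := CyclotomicField.isCyclotomicExtension N ℚ
    rwa [Subsingleton.elim (CyclotomicField.algebra N ℚ) DivisionRing.toRatAlgebra] at h
  obtain ⟨E, _, _, h⟩ := exists_isFixedByKer (CyclotomicField N ℚ) χ
  obtain ⟨h1, h2, h3, h4⟩ := h.isGalois_and_isCyclic hsurj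
  have := h.isTotallyComplex hχ1
  have h1' : IsAbelianGalois ℚ E := (h.isGalois_and_isCyclic hsurj).1
  have : IsCMField E := IsCMField.of_isAbelianGalois E
  refine ⟨E, ⟨h1.toIsGalois, h2, h3, h4⟩, ⟨exists_im_ne_zero_of_isTotallyComplex,
    exists_subfield_of_isCMField E⟩, fun l hl ↦ ?_⟩
  obtain ⟨u, hu, hχu⟩ := hχ l (Finset.mem_insert_of_mem hl)
  exact h.isPrime_span hsurj (hS l hl) hu hχu

end InertPrimes

end

set_option synthInstance.maxHeartbeats 1000000 in
/-- For an odd positive integer `d` and finitely many rational primes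
`l 0, …, l (r-1)`, there exist infinitely many number fields `E` (as subfields of a fixed
algebraic closure of `ℚ`) such that: (i) `E/ℚ` is Galois with cyclic Galois group of order
`2d`; (ii) `E` is a CM field (totally imaginary with a totally real subfield over which `E`
is quadratic); and (iii) each prime `l i` is inert in `E`, i.e. generates a prime ideal of
the ring of integers of `E`. -/
theorem stmt_3 (d : ℕ) (hd : Odd d) (hd0 : 0 < d) (r : ℕ) (l : Fin r → ℕ)
    (hl : ∀ i, (l i).Prime) :
    {E : IntermediateField ℚ (AlgebraicClosure ℚ) |
      (IsGalois ℚ E ∧ IsCyclic (E ≃ₐ[ℚ] E) ∧ Nat.card (E ≃ₐ[ℚ] E) = 2 * d ∧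
        Module.finrank ℚ E = 2 * d) ∧
      ((∀ ψ : E →+* ℂ, ∃ x, (ψ x).im ≠ 0) ∧
        ∃ F : Subfield E, (∀ ψ : F →+* ℂ, ∀ x, (ψ x).im = 0) ∧ Module.finrank F E = 2) ∧
      (∀ i, (Ideal.span {(l i : NumberField.RingOfIntegers E)}).IsPrime)}.Infinite := by
  intro hfin
  have hram : ∀ E : IntermediateField ℚ (AlgebraicClosure ℚ), ∃ p : ℕ, p.Prime ∧
      (IsGalois ℚ E → Module.finrank ℚ E = 2 * d →
        ¬ (Ideal.span {(p : NumberField.RingOfIntegers E)}).IsPrime) := by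
    intro E
    by_cases hE : IsGalois ℚ E ∧ Module.finrank ℚ E = 2 * d
    · obtain ⟨p, hp, h⟩ := exists_prime_not_isPrime_span_intermediateField E hE.1 (by omega)
      exact ⟨p, hp, fun _ _ ↦ h⟩
    · exact ⟨2, Nat.prime_two, fun h1 h2 ↦ absurd ⟨h1, h2⟩ hE⟩
  choose p hp hpE using hram
  classical
  obtain ⟨E, hE1, hE2, hE3⟩ := exists_intermediateField hd
    (S := Finset.univ.image l ∪ hfin.toFinset.image p) fun q hq ↦ by
      obtain hq | hq := Finset.mem_union.1 hq <;> obtain ⟨i, -, rfl⟩ := Finset.mem_image.1 hq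
      exacts [hl i, hp i]
  refine hpE E hE1.1 hE1.2.2.2 (hE3 _ ?_)
  refine Finset.mem_union_right _ (Finset.mem_image_of_mem p (hfin.mem_toFinset.2 ?_))
  exact ⟨hE1, hE2, fun i ↦ hE3 _ (Finset.mem_union_left _
    (Finset.mem_image_of_mem l (Finset.mem_univ i)))⟩
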